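/- Let u be a nonnegative entire bounded solution of Δ^{α/2}u = ρ·φ(u) on ℝ^N. Then for every x ∈ ℝ^N, u(x) + C_{N,α}·∫_{ℝ^N} ρ(y)·φ(u(y))·|x−y|^{-(N−α)} dy = sup_{ℝ^N} u, where C_{N,α} = 2^{-α}·π^{-N/2}·Γ((N−α)/2)/Γ(α/2). -/

import Mathlib

open MeasureTheory Real Filter Topology

noncomputable section

/-- The constant `c_{N,-α} = 2^α · π^{-N/2} · Γ((N+α)/2) / |Γ(-α/2)|`. -/
def fracLapCoeff (N : ℕ) (α : ℝ) : ℝ :=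
  2 ^ α * Real.pi ^ (-(N : ℝ) / 2) * Real.Gamma (((N : ℝ) + α) / 2) / |Real.Gamma (-α / 2)|

/-- The fractional Laplacian `Δ^{α/2}θ` of a test function `θ`. -/
def fracLap (N : ℕ) (α : ℝ) (θ : EuclideanSpace ℝ (Fin N) → ℝ)
    (x : EuclideanSpace ℝ (Fin N)) : ℝ :=
  (fracLapCoeff N α / 2) *
    ∫ z : EuclideanSpace ℝ (Fin N), (θ (x + z) + θ (x - z) - 2 * θ x) / ‖z‖ ^ ((N : ℝ) + α)

/-- A nonnegative entire bounded (distributional) solution of `Δ^{α/2}u = ρ·φ(u)` on `ℝ^N`. -/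
def IsEntireSol (N : ℕ) (α : ℝ) (ρ : EuclideanSpace ℝ (Fin N) → ℝ) (φ : ℝ → ℝ)
    (u : EuclideanSpace ℝ (Fin N) → ℝ) : Prop :=
  Continuous u ∧ (∃ M, ∀ x, u x ≤ M) ∧ (∀ x, 0 ≤ u x) ∧
  LocallyIntegrable (fun x => ρ x * φ (u x)) ∧
  ∀ θ : EuclideanSpace ℝ (Fin N) → ℝ, ContDiff ℝ (⊤ : ℕ∞) θ → HasCompactSupport θ →
    (∫ x, u x * fracLap N α θ x) = ∫ x, ρ x * φ (u x) * θ x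

/-- The Riesz constant `C_{N,α} = 2^{-α} · π^{-N/2} · Γ((N-α)/2) / Γ(α/2)`. -/
def rieszCoeff (N : ℕ) (α : ℝ) : ℝ :=
  2 ^ (-α) * Real.pi ^ (-(N : ℝ) / 2) * Real.Gamma (((N : ℝ) - α) / 2) / Real.Gamma (α / 2)

/-- The Gauss–Weierstrass heat kernel on `ℝ^N` at time `t`. -/
def heatKernel {N : ℕ} (t : ℝ) (y : EuclideanSpace ℝ (Fin N)) : ℝ :=
  (4 * Real.pi * t) ^ (-(N : ℝ) / 2) * Real.exp (-(4 * t)⁻¹ * ‖y‖ ^ 2)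

lemma heatKernel_nonneg {N : ℕ} {t : ℝ} (ht : 0 < t) (y : EuclideanSpace ℝ (Fin N)) :
    0 ≤ heatKernel t y := by
  unfold heatKernel; positivity

lemma heatKernel_neg {N : ℕ} (t : ℝ) (y : EuclideanSpace ℝ (Fin N)) :
    heatKernel t (-y) = heatKernel t y := by
  simp [heatKernel]

lemma heatKernel_sub_comm {N : ℕ} (t : ℝ) (x y : EuclideanSpace ℝ (Fin N)) :
    heatKernel t (x - y) = heatKernel t (y - x) := by
  rw [← heatKernel_neg, neg_sub]

lemma continuous_heatKernel {N : ℕ} (t : ℝ) :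
    Continuous (heatKernel t : EuclideanSpace ℝ (Fin N) → ℝ) := by
  unfold heatKernel; fun_prop

lemma integral_exp_neg_mul_norm_sq {N : ℕ} {b : ℝ} (hb : 0 < b) :
    ∫ y : EuclideanSpace ℝ (Fin N), Real.exp (-b * ‖y‖ ^ 2) = (Real.pi / b) ^ ((N : ℝ) / 2) := by
  simpa using GaussianFourier.integral_rexp_neg_mul_sq_norm (V := EuclideanSpace ℝ (Fin N)) hb

lemma integrable_exp_neg_mul_norm_sq {N : ℕ} {b : ℝ} (hb : 0 < b) :
    Integrable (fun y : EuclideanSpace ℝ (Fin N) => Real.exp (-b * ‖y‖ ^ 2)) := by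
  by_contra h
  have h1 := integral_exp_neg_mul_norm_sq (N := N) hb
  rw [integral_undef h] at h1
  have : 0 < (Real.pi / b) ^ ((N : ℝ) / 2) := by positivity
  exact this.ne h1

lemma integrable_heatKernel {N : ℕ} {t : ℝ} (ht : 0 < t) :
    Integrable (heatKernel t : EuclideanSpace ℝ (Fin N) → ℝ) :=
  (integrable_exp_neg_mul_norm_sq (by positivity)).const_mul _

lemma integral_heatKernel {N : ℕ} {t : ℝ} (ht : 0 < t) :
    ∫ y : EuclideanSpace ℝ (Fin N), heatKernel t y = 1 := by
  unfold heatKernel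
  rw [integral_const_mul, integral_exp_neg_mul_norm_sq (by positivity)]
  have : Real.pi / (4 * t)⁻¹ = 4 * Real.pi * t := by field_simp
  rw [this, ← Real.rpow_add (by positivity)]
  have : -(N : ℝ) / 2 + N / 2 = 0 := by ring
  rw [this, Real.rpow_zero]

lemma integrable_heatKernel_sub {N : ℕ} {t : ℝ} (ht : 0 < t) (x : EuclideanSpace ℝ (Fin N)) :
    Integrable (fun y => heatKernel t (x - y)) :=
  (integrable_heatKernel ht).comp_sub_left x

lemma integral_heatKernel_sub {N : ℕ} {t : ℝ} (ht : 0 < t) (x : EuclideanSpace ℝ (Fin N)) :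
    ∫ y, heatKernel t (x - y) = 1 := by
  rw [integral_sub_left_eq_self (fun y => heatKernel t y) volume x, integral_heatKernel ht]

/-- The semigroup property of the heat kernel. -/
lemma integral_heatKernel_mul_heatKernel {N : ℕ} {r t : ℝ} (hr : 0 < r) (ht : 0 < t)
    (y : EuclideanSpace ℝ (Fin N)) :
    ∫ z, heatKernel r z * heatKernel t (y - z) = heatKernel (t + r) y := by
  have hrt : 0 < t + r := by positivity
  have key : ∀ z : EuclideanSpace ℝ (Fin N), heatKernel r z * heatKernel t (y - z) =
      (4 * Real.pi * r) ^ (-(N : ℝ) / 2) * (4 * Real.pi * t) ^ (-(N : ℝ) / 2) *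
        Real.exp (-(4 * (t + r))⁻¹ * ‖y‖ ^ 2) *
        Real.exp (-((t + r) / (4 * r * t)) * ‖z - (r / (t + r)) • y‖ ^ 2) := by
    intro z
    unfold heatKernel
    rw [mul_mul_mul_comm, ← Real.exp_add,
      mul_assoc _ (Real.exp (-(4 * (t + r))⁻¹ * ‖y‖ ^ 2)) _, ← Real.exp_add]
    congr 2
    rw [norm_sub_sq_real, norm_sub_sq_real, norm_smul, inner_smul_right, mul_pow,
      Real.norm_eq_abs, sq_abs, real_inner_comm y z]
    field_simp
    ring
  simp_rw [key]
  rw [integral_const_mul,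
    integral_sub_right_eq_self (fun z => Real.exp (-((t + r) / (4 * r * t)) * ‖z‖ ^ 2)),
    integral_exp_neg_mul_norm_sq (by positivity)]
  unfold heatKernel
  have e : Real.pi / ((t + r) / (4 * r * t)) =
      (4 * Real.pi * r) * (4 * Real.pi * t) / (4 * Real.pi * (t + r)) := by
    field_simp
  have e' : ∀ A B C X : ℝ, 0 < A → 0 < B → 0 < C →
      A ^ (-(N : ℝ) / 2) * B ^ (-(N : ℝ) / 2) * X * (A * B / C) ^ ((N : ℝ) / 2) =
        C ^ (-(N : ℝ) / 2) * X := by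
    intro A B C X hA hB hC
    rw [Real.div_rpow (by positivity) hC.le, Real.mul_rpow hA.le hB.le, neg_div,
      Real.rpow_neg hA.le, Real.rpow_neg hB.le, Real.rpow_neg hC.le]
    field_simp
  rw [e, e' _ _ _ _ (by positivity) (by positivity) (by positivity)]

/-- Comparison of the heat kernel at times `t` and `t * (1 + p)`. -/
lemma abs_heatKernel_sub_le {N : ℕ} {t p : ℝ} (ht : 0 < t) (hp : 0 < p) (hp1 : p ≤ 1)
    (y : EuclideanSpace ℝ (Fin N)) :
    |heatKernel (t * (1 + p)) y - heatKernel t y| ≤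
      p * ((N / 2 + 4) * 4 ^ ((N : ℝ) / 2)) * heatKernel (4 * t) y := by
  set a : ℝ := (4 * t)⁻¹ * ‖y‖ ^ 2 with ha
  have ha0 : 0 ≤ a := by positivity
  set q : ℝ := (1 + p) ^ (-(N : ℝ) / 2) with hq
  have hq1 : q ≤ 1 := Real.rpow_le_one_of_one_le_of_nonpos (by linarith)
    (by have : (0 : ℝ) ≤ N := by positivity
        linarith)
  have hq2 : 1 - N / 2 * p ≤ q := by
    have h4 := Real.add_one_le_exp (-(N / 2 * Real.log (1 + p)))
    have h5 : q = Real.exp (-(N / 2 * Real.log (1 + p))) := by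
      rw [hq, Real.rpow_def_of_pos (by positivity)]; congr 1; ring
    have h6 : Real.log (1 + p) ≤ p := by
      have := Real.log_le_sub_one_of_pos (show 0 < 1 + p by positivity); linarith
    have h7 : (N : ℝ) / 2 * Real.log (1 + p) ≤ N / 2 * p := by gcongr
    linarith
  have hk : heatKernel (t * (1 + p)) y =
      (4 * Real.pi * t) ^ (-(N : ℝ) / 2) * (q * Real.exp (-(a / (1 + p)))) := by
    unfold heatKernel
    rw [← mul_assoc (4 * Real.pi), Real.mul_rpow (by positivity) (by positivity), mul_assoc]
    congr 3
    rw [ha]; field_simp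
  have hk2 : heatKernel t y = (4 * Real.pi * t) ^ (-(N : ℝ) / 2) * Real.exp (-a) := by
    unfold heatKernel; rw [ha]; congr 2; ring
  have hk3 : 4 ^ ((N : ℝ) / 2) * heatKernel (4 * t) y =
      (4 * Real.pi * t) ^ (-(N : ℝ) / 2) * Real.exp (-(a / 4)) := by
    unfold heatKernel
    rw [show 4 * Real.pi * (4 * t) = 4 * (4 * Real.pi * t) by ring,
      Real.mul_rpow (x := 4) (by positivity) (by positivity), ← mul_assoc, ← mul_assoc,
      ← Real.rpow_add (by positivity), show (N : ℝ) / 2 + -N / 2 = 0 by ring, Real.rpow_zero,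
      one_mul, ha]
    congr 2; ring
  have e1 : Real.exp (-(a / (1 + p))) ≤ Real.exp (-(a / 2)) := by
    apply Real.exp_le_exp.2
    have : a / 2 ≤ a / (1 + p) := by gcongr; linarith
    linarith
  have e2 : Real.exp (-(a / 2)) ≤ Real.exp (-(a / 4)) := by
    apply Real.exp_le_exp.2; linarith
  have e3 : a * Real.exp (-(a / 2)) ≤ 4 * Real.exp (-(a / 4)) := by
    have h1 : a ≤ 4 * Real.exp (a / 4) := by
      have := Real.add_one_le_exp (a / 4); linarith
    calc a * Real.exp (-(a / 2)) ≤ 4 * Real.exp (a / 4) * Real.exp (-(a / 2)) := by gcongr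
      _ = 4 * Real.exp (-(a / 4)) := by
        rw [mul_assoc, ← Real.exp_add]; congr 2; ring
  have e4 : Real.exp (-(a / (1 + p))) - Real.exp (-a) ≤ p * (a * Real.exp (-(a / (1 + p)))) := by
    have h1 : Real.exp (-a) = Real.exp (-(a / (1 + p))) * Real.exp (-(a * p / (1 + p))) := by
      rw [← Real.exp_add]; congr 1; field_simp; ring
    have h2 := Real.add_one_le_exp (-(a * p / (1 + p)))
    have h3 : a * p / (1 + p) ≤ a * p := div_le_self (by positivity) (by linarith)
    rw [h1]
    have h4 : 0 < Real.exp (-(a / (1 + p))) := Real.exp_pos _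
    nlinarith
  have e5 : Real.exp (-a) ≤ Real.exp (-(a / (1 + p))) := by
    apply Real.exp_le_exp.2
    have : a / (1 + p) ≤ a := div_le_self ha0 (by linarith)
    linarith
  have hfin : |q * Real.exp (-(a / (1 + p))) - Real.exp (-a)| ≤
      p * (N / 2 + 4) * Real.exp (-(a / 4)) := by
    have p1 : 0 < Real.exp (-(a / (1 + p))) := Real.exp_pos _
    have hN : (0 : ℝ) ≤ N / 2 := by positivity
    have p3 : a * Real.exp (-(a / (1 + p))) ≤ 4 * Real.exp (-(a / 4)) :=
      (mul_le_mul_of_nonneg_left e1 ha0).trans e3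
    have p4 := mul_le_mul_of_nonneg_left p3 hp.le
    have p5 : N / 2 * p * Real.exp (-(a / (1 + p))) ≤ N / 2 * p * Real.exp (-(a / 4)) := by
      exact mul_le_mul_of_nonneg_left (e1.trans e2) (by positivity)
    have p6 := mul_le_mul_of_nonneg_right hq1 p1.le
    have p7 := mul_le_mul_of_nonneg_right hq2 p1.le
    have p8 : 0 ≤ N / 2 * p * Real.exp (-(a / 4)) := by positivity
    have p9 : 0 ≤ p * (4 * Real.exp (-(a / 4))) := by positivity
    rw [abs_le]; constructor <;> nlinarith
  rw [hk, hk2, ← mul_sub, abs_mul, abs_of_nonneg (by positivity)]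
  calc _ ≤ (4 * Real.pi * t) ^ (-(N : ℝ) / 2) * (p * (N / 2 + 4) * Real.exp (-(a / 4))) := by
        gcongr
    _ = p * (N / 2 + 4) * (4 ^ ((N : ℝ) / 2) * heatKernel (4 * t) y) := by rw [hk3]; ring
    _ = _ := by ring

/-- The Mellin transform in time of the heat kernel. -/
lemma integral_rpow_mul_heatKernel {N : ℕ} {γ : ℝ} (hγ : 0 < (N : ℝ) / 2 - γ)
    {y : EuclideanSpace ℝ (Fin N)} (hy : y ≠ 0) :
    ∫ t in Set.Ioi (0 : ℝ), t ^ (γ - 1) * heatKernel t y =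
      2 ^ (-2 * γ) * Real.pi ^ (-(N : ℝ) / 2) * Real.Gamma ((N : ℝ) / 2 - γ) *
        ‖y‖ ^ (2 * γ - N) := by
  have hny : 0 < ‖y‖ := norm_pos_iff.2 hy
  rw [← integral_comp_rpow_Ioi _ (show (-1 : ℝ) ≠ 0 by norm_num)]
  have : ∀ x ∈ Set.Ioi (0 : ℝ), (|(-1 : ℝ)| * x ^ ((-1 : ℝ) - 1)) •
      ((x ^ (-1 : ℝ)) ^ (γ - 1) * heatKernel (x ^ (-1 : ℝ)) y) =
      (4 * Real.pi) ^ (-(N : ℝ) / 2) *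
        (x ^ (((N : ℝ) / 2 - γ) - 1) * Real.exp (-((‖y‖ ^ 2 / 4) * x))) := by
    intro x hx
    have hx : 0 < x := hx
    unfold heatKernel
    rw [Real.mul_rpow (by positivity) (by positivity), ← Real.rpow_mul hx.le,
      ← Real.rpow_mul hx.le, smul_eq_mul, abs_neg, abs_one, one_mul]
    have e : -(4 * x ^ (-1 : ℝ))⁻¹ * ‖y‖ ^ 2 = -((‖y‖ ^ 2 / 4) * x) := by
      rw [Real.rpow_neg_one]; field_simp
    have e2 : ((N : ℝ) / 2 - γ) - 1 = (-1 - 1) + -1 * (γ - 1) + -1 * (-(N : ℝ) / 2) := by ring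
    rw [e, e2, Real.rpow_add hx, Real.rpow_add hx]
    ring
  rw [setIntegral_congr_fun measurableSet_Ioi this, integral_const_mul,
    Real.integral_rpow_mul_exp_neg_mul_Ioi hγ (by positivity)]
  have e1 : (1 / (‖y‖ ^ 2 / 4)) ^ ((N : ℝ) / 2 - γ) =
      4 ^ ((N : ℝ) / 2 - γ) * ‖y‖ ^ (2 * γ - N) := by
    rw [show 1 / (‖y‖ ^ 2 / 4) = 4 * (‖y‖ ^ (-2 : ℝ)) by
      rw [Real.rpow_neg hny.le]; norm_cast; field_simp,
      Real.mul_rpow (by positivity) (by positivity), ← Real.rpow_mul hny.le]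
    congr 2; ring
  have e2 : (4 * Real.pi) ^ (-(N : ℝ) / 2) * 4 ^ ((N : ℝ) / 2 - γ) =
      2 ^ (-2 * γ) * Real.pi ^ (-(N : ℝ) / 2) := by
    rw [Real.mul_rpow (by positivity) (by positivity), mul_right_comm,
      ← Real.rpow_add (by positivity), show -(N : ℝ) / 2 + (N / 2 - γ) = -γ by ring,
      show (4 : ℝ) = 2 ^ (2 : ℝ) by norm_num, ← Real.rpow_mul (by norm_num)]
    congr 2; ring
  rw [e1, mul_assoc (4 ^ _), ← mul_assoc, e2]
  ring

lemma integrableOn_rpow_mul_heatKernel {N : ℕ} {γ : ℝ} (hγ : 0 < (N : ℝ) / 2 - γ)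
    {y : EuclideanSpace ℝ (Fin N)} (hy : y ≠ 0) :
    IntegrableOn (fun t => t ^ (γ - 1) * heatKernel t y) (Set.Ioi (0 : ℝ)) := by
  by_contra h
  have h1 := integral_rpow_mul_heatKernel hγ hy
  rw [integral_undef h] at h1
  have hny : 0 < ‖y‖ := norm_pos_iff.2 hy
  have h2 := Real.Gamma_pos_of_pos hγ
  have : 0 < 2 ^ (-2 * γ) * Real.pi ^ (-(N : ℝ) / 2) * Real.Gamma ((N : ℝ) / 2 - γ) *
        ‖y‖ ^ (2 * γ - N) := by positivity
  exact this.ne h1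


lemma integrableOn_rpow_neg_div_one_add {β : ℝ} (hβ0 : 0 < β) (hβ1 : β < 1) :
    IntegrableOn (fun q : ℝ => q ^ (-β) * (1 + q)⁻¹) (Set.Ioi 0) := by
  rw [← Set.Ioc_union_Ioi_eq_Ioi (zero_le_one (α := ℝ))]
  refine IntegrableOn.union ?_ ?_
  · have h : IntegrableOn (fun q : ℝ => q ^ (-β)) (Set.Ioc 0 1) :=
      (intervalIntegrable_iff_integrableOn_Ioc_of_le zero_le_one).1
        (intervalIntegral.intervalIntegrable_rpow' (by linarith))
    refine Integrable.mono' h (by fun_prop) ?_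
    filter_upwards [ae_restrict_mem measurableSet_Ioc] with q hq
    have h0 : 0 < q := hq.1
    rw [Real.norm_of_nonneg (by positivity)]
    exact mul_le_of_le_one_right (by positivity) (inv_le_one_of_one_le₀ (by linarith))
  · have h : IntegrableOn (fun q : ℝ => q ^ (-β - 1)) (Set.Ioi 1) :=
      integrableOn_Ioi_rpow_of_lt (by linarith) one_pos
    refine Integrable.mono' h (by fun_prop) ?_
    filter_upwards [ae_restrict_mem measurableSet_Ioi] with q hq
    have h0 : 0 < q := one_pos.trans hq
    rw [Real.norm_of_nonneg (by positivity), Real.rpow_sub_one h0.ne', div_eq_mul_inv]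
    gcongr
    linarith

/-- `∫ q^{-β} / (1 + q) dq = Γ(β) Γ(1 - β)` over `(0, ∞)`. -/
lemma integral_rpow_neg_div_one_add {β : ℝ} (hβ0 : 0 < β) (hβ1 : β < 1) :
    ∫ q in Set.Ioi (0 : ℝ), q ^ (-β) * (1 + q)⁻¹ = Real.Gamma β * Real.Gamma (1 - β) := by
  let F : ℝ × ℝ → ℝ := fun z => z.1 ^ (-β) * Real.exp (-((1 + z.1) * z.2))
  have hm : AEStronglyMeasurable F
      ((volume.restrict (Set.Ioi (0 : ℝ))).prod (volume.restrict (Set.Ioi (0 : ℝ)))) := by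
    apply Measurable.aestronglyMeasurable; fun_prop
  have hexp : ∀ q : ℝ, 0 < q → ∫ s in Set.Ioi (0 : ℝ), Real.exp (-((1 + q) * s)) = (1 + q)⁻¹ := by
    intro q hq
    have := Real.integral_rpow_mul_exp_neg_mul_Ioi one_pos (show 0 < 1 + q by positivity)
    simpa using this
  have hexpi : ∀ q : ℝ, 0 < q →
      IntegrableOn (fun s : ℝ => Real.exp (-((1 + q) * s))) (Set.Ioi 0) := by
    intro q hq
    simpa only [neg_mul] using exp_neg_integrableOn_Ioi 0 (show 0 < 1 + q by positivity)
  have hF : Integrable F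
      ((volume.restrict (Set.Ioi (0 : ℝ))).prod (volume.restrict (Set.Ioi (0 : ℝ)))) := by
    rw [integrable_prod_iff hm]
    constructor
    · filter_upwards [ae_restrict_mem measurableSet_Ioi] with q hq
      exact (hexpi q hq).const_mul (q ^ (-β))
    · refine (integrableOn_rpow_neg_div_one_add hβ0 hβ1).congr ?_
      filter_upwards [ae_restrict_mem measurableSet_Ioi] with q hq
      have hq : 0 < q := hq
      simp_rw [F, norm_mul, Real.norm_of_nonneg (Real.exp_nonneg _)]
      rw [integral_const_mul, hexp q hq, Real.norm_of_nonneg (by positivity)]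
  have h := integral_integral_swap (f := fun x y => F (x, y)) hF
  have h1 : ∫ q in Set.Ioi (0 : ℝ), q ^ (-β) * (1 + q)⁻¹ =
      ∫ q in Set.Ioi (0 : ℝ), ∫ s in Set.Ioi (0 : ℝ), F (q, s) := by
    refine setIntegral_congr_fun measurableSet_Ioi fun q hq => ?_
    simp only [F]
    rw [integral_const_mul, hexp q hq]
  have h2 : ∀ s ∈ Set.Ioi (0 : ℝ), ∫ q in Set.Ioi (0 : ℝ), F (q, s) =
      Real.Gamma (1 - β) * (Real.exp (-s) * s ^ (β - 1)) := by
    intro s hs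
    have hs : 0 < s := hs
    have e : ∀ q, F (q, s) = Real.exp (-s) * (q ^ ((1 - β) - 1) * Real.exp (-(s * q))) := by
      intro q
      simp only [F]
      rw [show -((1 + q) * s) = -s + -(s * q) by ring, Real.exp_add,
        show 1 - β - 1 = -β by ring]
      ring
    simp_rw [e]
    rw [integral_const_mul, Real.integral_rpow_mul_exp_neg_mul_Ioi (by linarith) hs, one_div,
      Real.inv_rpow hs.le, ← Real.rpow_neg hs.le, show -(1 - β) = β - 1 by ring]
    ring
  rw [h1, h, setIntegral_congr_fun measurableSet_Ioi h2, integral_const_mul,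
    ← Real.Gamma_eq_integral hβ0, mul_comm]

/-- Fubini for the power weight `p^{-1-β}` against primitives. -/
lemma integral_rpow_mul_primitive {β : ℝ} (hβ0 : 0 < β) (hβ1 : β < 1) {ω : ℝ → ℝ}
    (hω : Measurable ω) {K : ℝ} (hK : ∀ q, 0 < q → |ω q| ≤ K) :
    ∫ p in Set.Ioi (0 : ℝ), p ^ (-1 - β) * ∫ q in (0 : ℝ)..p, ω q * (1 + q)⁻¹ =
      β⁻¹ * ∫ q in Set.Ioi (0 : ℝ), q ^ (-β) * (1 + q)⁻¹ * ω q := by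
  let F : ℝ × ℝ → ℝ := fun z =>
    Set.indicator {w : ℝ × ℝ | w.2 < w.1} (fun w => w.1 ^ (-1 - β) * (ω w.2 * (1 + w.2)⁻¹)) z
  have hms : MeasurableSet {w : ℝ × ℝ | w.2 < w.1} := measurableSet_lt measurable_snd measurable_fst
  have hm : AEStronglyMeasurable F
      ((volume.restrict (Set.Ioi (0 : ℝ))).prod (volume.restrict (Set.Ioi (0 : ℝ)))) := by
    apply Measurable.aestronglyMeasurable
    refine Measurable.indicator ?_ hms
    fun_prop
  have hFq : ∀ q : ℝ, (fun p => F (p, q)) =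
      Set.indicator (Set.Ioi q) (fun p => p ^ (-1 - β) * (ω q * (1 + q)⁻¹)) := by
    intro q; ext p; simp [F, Set.indicator]
  have hrest : ∀ q : ℝ, 0 < q →
      (volume.restrict (Set.Ioi (0 : ℝ))).restrict (Set.Ioi q) = volume.restrict (Set.Ioi q) := by
    intro q hq
    rw [Measure.restrict_restrict measurableSet_Ioi,
      Set.inter_eq_left.2 (Set.Ioi_subset_Ioi hq.le)]
  have hpow : ∀ q : ℝ, 0 < q → IntegrableOn (fun p : ℝ => p ^ (-1 - β)) (Set.Ioi q) :=
    fun q hq => integrableOn_Ioi_rpow_of_lt (by linarith) hq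
  have hpowi : ∀ q : ℝ, 0 < q → ∫ p in Set.Ioi q, p ^ (-1 - β) = β⁻¹ * q ^ (-β) := by
    intro q hq
    rw [integral_Ioi_rpow_of_lt (by linarith) hq, show -1 - β + 1 = -β by ring]
    field_simp
  have hI : IntegrableOn (fun q : ℝ => q ^ (-β) * (1 + q)⁻¹ * ω q) (Set.Ioi 0) := by
    refine Integrable.mono' ((integrableOn_rpow_neg_div_one_add hβ0 hβ1).mul_const K)
      (by fun_prop) ?_
    filter_upwards [ae_restrict_mem measurableSet_Ioi] with q hq
    have hq : 0 < q := hq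
    rw [norm_mul, Real.norm_of_nonneg (by positivity)]
    exact mul_le_mul_of_nonneg_left (hK q hq) (by positivity)
  have hF : Integrable F
      ((volume.restrict (Set.Ioi (0 : ℝ))).prod (volume.restrict (Set.Ioi (0 : ℝ)))) := by
    rw [integrable_prod_iff' hm]
    constructor
    · filter_upwards [ae_restrict_mem measurableSet_Ioi] with q hq
      rw [hFq, integrable_indicator_iff measurableSet_Ioi, IntegrableOn, hrest q hq]
      exact (hpow q hq).mul_const _
    · refine (hI.norm.const_mul β⁻¹).congr ?_
      filter_upwards [ae_restrict_mem measurableSet_Ioi] with q hq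
      have hq' : 0 < q := hq
      have e : (fun p => ‖F (p, q)‖) =
          Set.indicator (Set.Ioi q) (fun p => ‖p ^ (-1 - β) * (ω q * (1 + q)⁻¹)‖) := by
        ext p
        have : F (p, q) = _ := congrFun (hFq q) p
        rw [this, norm_indicator_eq_indicator_norm]
      rw [e, integral_indicator measurableSet_Ioi, hrest q hq]
      have e2 : ∫ p in Set.Ioi q, ‖p ^ (-1 - β) * (ω q * (1 + q)⁻¹)‖ =
          ∫ p in Set.Ioi q, p ^ (-1 - β) * ‖(ω q * (1 + q)⁻¹)‖ := by
        refine setIntegral_congr_fun measurableSet_Ioi fun p hp => ?_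
        have hp : 0 < p := hq'.trans hp
        simp only [norm_mul]
        rw [Real.norm_of_nonneg (show 0 ≤ p ^ (-1 - β) by positivity)]
      rw [e2, integral_mul_const, hpowi q hq', norm_mul, norm_mul, norm_mul,
        Real.norm_of_nonneg (show 0 ≤ q ^ (-β) by positivity)]
      ring
  have h := integral_integral_swap (f := fun x y => F (x, y)) hF
  have h1 : ∀ p ∈ Set.Ioi (0 : ℝ), p ^ (-1 - β) * ∫ q in (0 : ℝ)..p, ω q * (1 + q)⁻¹ =
      ∫ q in Set.Ioi (0 : ℝ), F (p, q) := by
    intro p hp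
    have e : (fun q => F (p, q)) =
        Set.indicator (Set.Iio p) (fun q => p ^ (-1 - β) * (ω q * (1 + q)⁻¹)) := by
      ext q; simp [F, Set.indicator]
    rw [e, integral_indicator measurableSet_Iio, Measure.restrict_restrict measurableSet_Iio,
      Set.Iio_inter_Ioi, ← integral_Ioc_eq_integral_Ioo, integral_const_mul,
      intervalIntegral.integral_of_le (le_of_lt hp)]
  have h2 : ∀ q ∈ Set.Ioi (0 : ℝ), ∫ p in Set.Ioi (0 : ℝ), F (p, q) =
      β⁻¹ * (q ^ (-β) * (1 + q)⁻¹ * ω q) := by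
    intro q hq
    rw [hFq, integral_indicator measurableSet_Ioi, hrest q hq, integral_mul_const, hpowi q hq]
    ring
  rw [setIntegral_congr_fun measurableSet_Ioi h1, h, setIntegral_congr_fun measurableSet_Ioi h2,
    integral_const_mul]

lemma integrableOn_rpow_mul_min {β : ℝ} (hβ0 : 0 < β) (hβ1 : β < 1) {A B : ℝ} (hA : 0 ≤ A)
    (hB : 0 ≤ B) :
    IntegrableOn (fun p : ℝ => p ^ (-1 - β) * min A (B * p)) (Set.Ioi 0) := by
  rw [← Set.Ioc_union_Ioi_eq_Ioi (zero_le_one (α := ℝ))]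
  refine IntegrableOn.union ?_ ?_
  · have h : IntegrableOn (fun q : ℝ => q ^ (-β)) (Set.Ioc 0 1) :=
      (intervalIntegrable_iff_integrableOn_Ioc_of_le zero_le_one).1
        (intervalIntegral.intervalIntegrable_rpow' (by linarith))
    refine Integrable.mono' (h.mul_const B) (by fun_prop) ?_
    filter_upwards [ae_restrict_mem measurableSet_Ioc] with q hq
    have h0 : 0 < q := hq.1
    rw [Real.norm_of_nonneg (by positivity)]
    calc q ^ (-1 - β) * min A (B * q) ≤ q ^ (-1 - β) * (B * q) := by
          gcongr; exact min_le_right _ _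
      _ = q ^ (-β) * B := by
          rw [show -β = (-1 - β) + 1 by ring, Real.rpow_add_one h0.ne']; ring
  · have h : IntegrableOn (fun q : ℝ => q ^ (-1 - β)) (Set.Ioi 1) :=
      integrableOn_Ioi_rpow_of_lt (by linarith) one_pos
    refine Integrable.mono' (h.mul_const A) (by fun_prop) ?_
    filter_upwards [ae_restrict_mem measurableSet_Ioi] with q hq
    have h0 : 0 < q := one_pos.trans hq
    rw [Real.norm_of_nonneg (by positivity)]
    gcongr; exact min_le_left _ _

/-- A fractional Frullani identity: integrating `t^{β-1}` against the Marchaud derivative of a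
bounded function `v` over `(ε, T)`. -/
lemma integral_rpow_mul_marchaud {β : ℝ} (hβ0 : 0 < β) (hβ1 : β < 1) {v : ℝ → ℝ}
    (hv : Measurable v) {M C : ℝ} (hM0 : 0 ≤ M) (hC0 : 0 ≤ C) (hM : ∀ t, 0 < t → |v t| ≤ M)
    (hC : ∀ t p, 0 < t → 0 < p → |v (t * (1 + p)) - v t| ≤ C * p) {ε T : ℝ} (hε : 0 < ε)
    (hεT : ε ≤ T) :
    IntegrableOn (fun t => t ^ (β - 1) *
        ∫ r in Set.Ioi (0 : ℝ), r ^ (-1 - β) * (v (t + r) - v t)) (Set.Ioc ε T) ∧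
      ∫ t in Set.Ioc ε T, t ^ (β - 1) *
          ∫ r in Set.Ioi (0 : ℝ), r ^ (-1 - β) * (v (t + r) - v t) =
        β⁻¹ * ∫ q in Set.Ioi (0 : ℝ), q ^ (-β) * (1 + q)⁻¹ * (v (T * (1 + q)) - v (ε * (1 + q))) := by
  have hT : 0 < T := hε.trans_le hεT
  let F : ℝ × ℝ → ℝ := fun z => z.1⁻¹ * (z.2 ^ (-1 - β) * (v (z.1 * (1 + z.2)) - v z.1))
  have hm : AEStronglyMeasurable F
      ((volume.restrict (Set.Ioc ε T)).prod (volume.restrict (Set.Ioi (0 : ℝ)))) := by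
    apply Measurable.aestronglyMeasurable; fun_prop
  have hF : Integrable F
      ((volume.restrict (Set.Ioc ε T)).prod (volume.restrict (Set.Ioi (0 : ℝ)))) := by
    have h1 : Integrable (fun _ : ℝ => ε⁻¹) (volume.restrict (Set.Ioc ε T)) := integrable_const _
    refine Integrable.mono' (h1.mul_prod
      (integrableOn_rpow_mul_min hβ0 hβ1 (show 0 ≤ 2 * M by positivity) hC0)) hm ?_
    rw [Measure.prod_restrict]
    filter_upwards [ae_restrict_mem (measurableSet_Ioc.prod measurableSet_Ioi)] with z hz
    have ht : 0 < z.1 := hε.trans hz.1.1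
    have hp : 0 < z.2 := hz.2
    simp only [F]
    rw [norm_mul, norm_mul, Real.norm_of_nonneg (by positivity : 0 ≤ z.1⁻¹),
      Real.norm_of_nonneg (by positivity : 0 ≤ z.2 ^ (-1 - β))]
    have hz1 : z.1⁻¹ ≤ ε⁻¹ := inv_anti₀ hε hz.1.1.le
    gcongr
    refine le_min ?_ (hC _ _ ht hp)
    have a1 := hM z.1 ht
    have a2 := hM (z.1 * (1 + z.2)) (by positivity)
    rw [Real.norm_eq_abs]
    rw [abs_le] at *
    constructor <;> linarith
  have hG : ∀ t ∈ Set.Ioc ε T, ∫ p in Set.Ioi (0 : ℝ), F (t, p) = t ^ (β - 1) *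
      ∫ r in Set.Ioi (0 : ℝ), r ^ (-1 - β) * (v (t + r) - v t) := by
    intro t ht
    have ht : 0 < t := hε.trans ht.1
    have h := integral_comp_mul_left_Ioi (fun r => r ^ (-1 - β) * (v (t + r) - v t)) 0 ht
    rw [mul_zero, smul_eq_mul] at h
    have h' : ∫ r in Set.Ioi (0 : ℝ), r ^ (-1 - β) * (v (t + r) - v t) =
        t * ∫ x in Set.Ioi (0 : ℝ), (t * x) ^ (-1 - β) * (v (t + t * x) - v t) := by
      rw [h]; field_simp
    rw [h', ← mul_assoc, ← integral_const_mul]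
    refine setIntegral_congr_fun measurableSet_Ioi fun p hp => ?_
    have hp : 0 < p := hp
    simp only [F]
    rw [Real.mul_rpow ht.le hp.le, show t + t * p = t * (1 + p) by ring,
      ← Real.rpow_add_one ht.ne', show t⁻¹ = t ^ (β - 1 + 1) * t ^ (-1 - β) by
        rw [← Real.rpow_add ht, show β - 1 + 1 + (-1 - β) = -1 by ring, Real.rpow_neg_one]]
    ring
  constructor
  · exact (integrableOn_congr_fun hG measurableSet_Ioc).1 hF.integral_prod_left
  have hvint : ∀ a b : ℝ, 0 < a → 0 < b → IntervalIntegrable (fun t => t⁻¹ * v t) volume a b := by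
    intro a b ha hb
    have hmin : 0 < min a b := lt_min ha hb
    have : IntervalIntegrable (fun _ : ℝ => (min a b)⁻¹ * M) volume a b := by simp
    refine this.mono_fun' (by fun_prop) ?_
    filter_upwards [ae_restrict_mem measurableSet_uIoc] with t ht
    have h1 : min a b < t := ht.1
    have ht0 : 0 < t := hmin.trans h1
    rw [norm_mul, Real.norm_of_nonneg (by positivity)]
    exact mul_le_mul (inv_anti₀ hmin h1.le) (hM t ht0) (norm_nonneg _) (by positivity)
  have hscale : ∀ a p : ℝ, 0 < a → 0 < p → ∫ s in a..a * (1 + p), s⁻¹ * v s =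
      ∫ q in (0 : ℝ)..p, v (a * (1 + q)) * (1 + q)⁻¹ := by
    intro a p ha hp
    have h := intervalIntegral.mul_integral_comp_add_mul (a := 0) (b := p)
      (f := fun s => s⁻¹ * v s) a a
    rw [mul_zero, add_zero, show a + a * p = a * (1 + p) by ring] at h
    rw [← h, ← intervalIntegral.integral_const_mul]
    refine intervalIntegral.integral_congr fun q hq => ?_
    rw [Set.uIcc_of_le hp.le] at hq
    have : 0 < 1 + q := by linarith [hq.1]
    rw [show a + a * q = a * (1 + q) by ring]
    field_simp
  have hFr : ∀ p ∈ Set.Ioi (0 : ℝ), ∫ t in Set.Ioc ε T, F (t, p) =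
      p ^ (-1 - β) * ∫ q in (0 : ℝ)..p, (v (T * (1 + q)) - v (ε * (1 + q))) * (1 + q)⁻¹ := by
    intro p hp
    have hp : 0 < p := hp
    have hp1 : 0 < 1 + p := by positivity
    have e : ∀ t, F (t, p) =
        p ^ (-1 - β) * ((1 + p) * ((t * (1 + p))⁻¹ * v (t * (1 + p))) - t⁻¹ * v t) := by
      intro t; simp only [F]; field_simp
    simp_rw [e]
    rw [integral_const_mul, ← intervalIntegral.integral_of_le hεT]
    congr 1
    have hi2 : IntervalIntegrable (fun t => (t * (1 + p))⁻¹ * v (t * (1 + p))) volume ε T := by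
      have := (hvint (ε * (1 + p)) (T * (1 + p)) (by positivity) (by positivity)).comp_mul_right
        (c := 1 + p)
      simpa [hp1.ne'] using this
    rw [intervalIntegral.integral_sub (hi2.const_mul _) (hvint _ _ hε hT),
      intervalIntegral.integral_const_mul,
      intervalIntegral.mul_integral_comp_mul_right (f := fun s => s⁻¹ * v s)]
    simp_rw [sub_mul]
    have hi3 : ∀ a, 0 < a → IntervalIntegrable (fun q => v (a * (1 + q)) * (1 + q)⁻¹) volume 0 p := by
      intro a ha
      have : IntervalIntegrable (fun _ : ℝ => M) volume 0 p := by simp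
      refine this.mono_fun' (by fun_prop) ?_
      filter_upwards [ae_restrict_mem measurableSet_uIoc] with q hq
      rw [Set.uIoc_of_le hp.le] at hq
      have hq0 : 0 < q := hq.1
      rw [norm_mul, Real.norm_of_nonneg (by positivity : 0 ≤ (1 + q)⁻¹)]
      calc _ ≤ M * 1 := mul_le_mul (hM _ (by positivity))
            (inv_le_one_of_one_le₀ (by linarith)) (by positivity) hM0
        _ = M := mul_one _
    rw [intervalIntegral.integral_sub (hi3 T hT) (hi3 ε hε), ← hscale T p hT hp,
      ← hscale ε p hε hp]
    have c1 := intervalIntegral.integral_add_adjacent_intervals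
      (hvint (ε * (1 + p)) T (by positivity) hT) (hvint T (T * (1 + p)) hT (by positivity))
    have c2 := intervalIntegral.integral_add_adjacent_intervals
      (hvint ε (ε * (1 + p)) hε (by positivity)) (hvint (ε * (1 + p)) T (by positivity) hT)
    linarith
  have h := integral_integral_swap (f := fun x y => F (x, y)) hF
  rw [setIntegral_congr_fun measurableSet_Ioc hG, setIntegral_congr_fun measurableSet_Ioi hFr] at h
  rw [h]
  refine integral_rpow_mul_primitive hβ0 hβ1 (K := 2 * M) (by fun_prop) fun q hq => ?_
  have a1 := hM (T * (1 + q)) (by positivity)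
  have a2 := hM (ε * (1 + q)) (by positivity)
  rw [abs_le] at *
  constructor <;> linarith


lemma abs_exp_sub_one_le_mul_exp_abs (w : ℝ) : |Real.exp w - 1| ≤ |w| * Real.exp |w| := by
  have h1 := Real.add_one_le_exp w
  have h2 := Real.add_one_le_exp (-w)
  have h3 : Real.exp w - 1 ≤ w * Real.exp w := by
    have : Real.exp (-w) * Real.exp w = 1 := by rw [← Real.exp_add]; simp
    nlinarith [Real.exp_pos w]
  have h4 : w * Real.exp w ≤ |w| * Real.exp |w| :=
    mul_le_mul (le_abs_self w) (Real.exp_le_exp.2 (le_abs_self w)) (Real.exp_nonneg _)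
      (abs_nonneg _)
  have h5 : |w| * 1 ≤ |w| * Real.exp |w| :=
    mul_le_mul_of_nonneg_left (Real.one_le_exp (abs_nonneg _)) (abs_nonneg _)
  rw [abs_le]
  constructor
  · linarith [neg_abs_le w]
  · linarith

lemma abs_exp_sub_one_sub_le (w : ℝ) : |Real.exp w - 1 - w| ≤ w ^ 2 * Real.exp |w| := by
  have h1 := Real.add_one_le_exp w
  have h2 := Real.add_one_le_exp (-w)
  have h3 : Real.exp w - 1 ≤ w * Real.exp w := by
    have : Real.exp (-w) * Real.exp w = 1 := by rw [← Real.exp_add]; simp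
    nlinarith [Real.exp_pos w]
  rw [abs_of_nonneg (by linarith)]
  calc Real.exp w - 1 - w ≤ w * (Real.exp w - 1) := by linarith
    _ ≤ |w * (Real.exp w - 1)| := le_abs_self _
    _ = |w| * |Real.exp w - 1| := abs_mul _ _
    _ ≤ |w| * (|w| * Real.exp |w|) := by gcongr; exact abs_exp_sub_one_le_mul_exp_abs w
    _ = w ^ 2 * Real.exp |w| := by rw [← mul_assoc, ← sq, sq_abs]

/-- First and second difference bounds for the heat kernel in the space variable. -/
lemma heatKernel_diff_bounds (N : ℕ) : ∃ K : ℝ, 0 ≤ K ∧ ∀ (t : ℝ) (y z : EuclideanSpace ℝ (Fin N)),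
    0 < t → ‖z‖ ≤ √t →
      |heatKernel t (y + z) - heatKernel t y| ≤ K * (‖z‖ / √t) * heatKernel (4 * t) y ∧
      |heatKernel t (y + z) + heatKernel t (y - z) - 2 * heatKernel t y| ≤
        K * (‖z‖ / √t) ^ 2 * heatKernel (4 * t) y := by
  refine ⟨5 * Real.exp 2 * 4 ^ ((N : ℝ) / 2), by positivity, fun t y z ht hz => ?_⟩
  have hst : 0 < √t := Real.sqrt_pos.2 ht
  have hsq : √t ^ 2 = t := Real.sq_sqrt ht.le
  set s : ℝ := ‖z‖ / √t with hs
  have hs0 : 0 ≤ s := by positivity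
  have hs1 : s ≤ 1 := by rw [hs, div_le_one hst]; exact hz
  set b : ℝ := ‖y‖ / (2 * √t) with hb
  have hb0 : 0 ≤ b := by positivity
  set ξ : ℝ := inner ℝ y z / (2 * t) with hξ
  have hξb : |ξ| ≤ b * s := by
    rw [hξ, abs_div, abs_of_pos (by positivity : 0 < 2 * t)]
    calc |inner ℝ y z| / (2 * t) ≤ ‖y‖ * ‖z‖ / (2 * t) := by
          gcongr; exact abs_real_inner_le_norm y z
      _ = b * s := by
          rw [hb, hs, div_mul_div_comm, mul_assoc, Real.mul_self_sqrt ht.le]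
  have hc : ∀ x : EuclideanSpace ℝ (Fin N), heatKernel t x =
      (4 * Real.pi * t) ^ (-(N : ℝ) / 2) * Real.exp (-(4 * t)⁻¹ * ‖x‖ ^ 2) := fun _ => rfl
  have hb2 : (4 * t)⁻¹ * ‖y‖ ^ 2 = b ^ 2 := by
    rw [hb, div_pow, mul_pow, hsq]; field_simp; ring
  have hs2 : (4 * t)⁻¹ * ‖z‖ ^ 2 = s ^ 2 / 4 := by
    rw [hs, div_pow, hsq]; field_simp
  have hk0 : heatKernel t y = (4 * Real.pi * t) ^ (-(N : ℝ) / 2) * Real.exp (-b ^ 2) := by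
    rw [hc, neg_mul, hb2]
  have hk1 : heatKernel t (y + z) = (4 * Real.pi * t) ^ (-(N : ℝ) / 2) *
      (Real.exp (-b ^ 2) * Real.exp (-ξ - s ^ 2 / 4)) := by
    rw [hc, ← Real.exp_add, ← hb2, ← hs2, norm_add_sq_real, hξ]
    congr 2; field_simp; ring
  have hk2 : heatKernel t (y - z) = (4 * Real.pi * t) ^ (-(N : ℝ) / 2) *
      (Real.exp (-b ^ 2) * Real.exp (ξ - s ^ 2 / 4)) := by
    rw [hc, ← Real.exp_add, ← hb2, ← hs2, norm_sub_sq_real, hξ]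
    congr 2; field_simp; ring
  have hk3 : 4 ^ ((N : ℝ) / 2) * heatKernel (4 * t) y =
      (4 * Real.pi * t) ^ (-(N : ℝ) / 2) * Real.exp (-(b ^ 2 / 4)) := by
    unfold heatKernel
    rw [show 4 * Real.pi * (4 * t) = 4 * (4 * Real.pi * t) by ring,
      Real.mul_rpow (x := 4) (by positivity) (by positivity), ← mul_assoc, ← mul_assoc,
      ← Real.rpow_add (by positivity), show (N : ℝ) / 2 + -N / 2 = 0 by ring, Real.rpow_zero,
      one_mul, ← hb2]
    congr 2; field_simp
  have hA : 0 ≤ (4 * Real.pi * t) ^ (-(N : ℝ) / 2) := by positivity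
  have hss : s ^ 2 ≤ s := by nlinarith
  have hw : ∀ w : ℝ, |w| ≤ |ξ| + s ^ 2 / 4 → |w| ≤ s * (b + 1 / 4) ∧ |w| ≤ b + 1 / 4 := by
    intro w hw
    have : |w| ≤ s * (b + 1 / 4) := by
      have : s * (b + 1 / 4) = b * s + s / 4 := by ring
      linarith
    exact ⟨this, this.trans (mul_le_of_le_one_left (by positivity) hs1)⟩
  have hw1 : |-ξ - s ^ 2 / 4| ≤ |ξ| + s ^ 2 / 4 := by
    rw [abs_le]; constructor <;> linarith [neg_abs_le ξ, le_abs_self ξ, sq_nonneg s]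
  have hw2 : |ξ - s ^ 2 / 4| ≤ |ξ| + s ^ 2 / 4 := by
    rw [abs_le]; constructor <;> linarith [neg_abs_le ξ, le_abs_self ξ, sq_nonneg s]
  have hfirst : ∀ w : ℝ, |w| ≤ |ξ| + s ^ 2 / 4 →
      |Real.exp w - 1| ≤ s * Real.exp (2 * b + 1 / 2) := by
    intro w h
    obtain ⟨h1, h2⟩ := hw w h
    calc |Real.exp w - 1| ≤ |w| * Real.exp |w| := abs_exp_sub_one_le_mul_exp_abs w
      _ ≤ s * (b + 1 / 4) * Real.exp (b + 1 / 4) := by gcongr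
      _ ≤ s * Real.exp (b + 1 / 4) * Real.exp (b + 1 / 4) := by
          gcongr; linarith [Real.add_one_le_exp (b + 1 / 4)]
      _ = s * Real.exp (2 * b + 1 / 2) := by
          rw [mul_assoc, ← Real.exp_add]; congr 2; ring
  have hsecond : ∀ w : ℝ, |w| ≤ |ξ| + s ^ 2 / 4 →
      |Real.exp w - 1 - w| ≤ 2 * s ^ 2 * Real.exp (2 * b + 1 / 2) := by
    intro w h
    obtain ⟨h1, h2⟩ := hw w h
    have h3 : (b + 1 / 4) ^ 2 ≤ 2 * Real.exp (b + 1 / 4) := by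
      have := Real.quadratic_le_exp_of_nonneg (show 0 ≤ b + 1 / 4 by positivity)
      linarith
    calc |Real.exp w - 1 - w| ≤ w ^ 2 * Real.exp |w| := abs_exp_sub_one_sub_le w
      _ = |w| ^ 2 * Real.exp |w| := by rw [sq_abs]
      _ ≤ (s * (b + 1 / 4)) ^ 2 * Real.exp (b + 1 / 4) := by gcongr
      _ = s ^ 2 * (b + 1 / 4) ^ 2 * Real.exp (b + 1 / 4) := by ring
      _ ≤ s ^ 2 * (2 * Real.exp (b + 1 / 4)) * Real.exp (b + 1 / 4) := by gcongr
      _ = 2 * s ^ 2 * (Real.exp (b + 1 / 4) * Real.exp (b + 1 / 4)) := by ring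
      _ = 2 * s ^ 2 * Real.exp (2 * b + 1 / 2) := by
          rw [← Real.exp_add]; congr 2; ring
  have hE : Real.exp (-b ^ 2) * Real.exp (2 * b + 1 / 2) ≤ Real.exp 2 * Real.exp (-(b ^ 2 / 4)) := by
    rw [← Real.exp_add, ← Real.exp_add]
    apply Real.exp_le_exp.2
    nlinarith [sq_nonneg (3 * b - 4)]
  have hP : 0 < Real.exp (-b ^ 2) := Real.exp_pos _
  have hR : Real.exp 2 * 4 ^ ((N : ℝ) / 2) * heatKernel (4 * t) y =
      (4 * Real.pi * t) ^ (-(N : ℝ) / 2) * (Real.exp 2 * Real.exp (-(b ^ 2 / 4))) := by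
    rw [mul_assoc, hk3]; ring
  have hQ : 0 < Real.exp 2 * Real.exp (-(b ^ 2 / 4)) := by positivity
  constructor
  · have e : heatKernel t (y + z) - heatKernel t y = (4 * Real.pi * t) ^ (-(N : ℝ) / 2) *
        (Real.exp (-b ^ 2) * (Real.exp (-ξ - s ^ 2 / 4) - 1)) := by
      rw [hk0, hk1]; ring
    rw [e, abs_mul, abs_mul, abs_of_nonneg hA, abs_of_pos hP]
    calc _ ≤ (4 * Real.pi * t) ^ (-(N : ℝ) / 2) *
          (Real.exp (-b ^ 2) * (s * Real.exp (2 * b + 1 / 2))) := by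
          gcongr; exact hfirst _ hw1
      _ = (4 * Real.pi * t) ^ (-(N : ℝ) / 2) *
          (s * (Real.exp (-b ^ 2) * Real.exp (2 * b + 1 / 2))) := by ring
      _ ≤ (4 * Real.pi * t) ^ (-(N : ℝ) / 2) *
          (s * (5 * (Real.exp 2 * Real.exp (-(b ^ 2 / 4))))) := by
          exact mul_le_mul_of_nonneg_left (mul_le_mul_of_nonneg_left (by linarith) hs0) hA
      _ = 5 * s * (Real.exp 2 * 4 ^ ((N : ℝ) / 2) * heatKernel (4 * t) y) := by rw [hR]; ring
      _ = _ := by ring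
  · have e : heatKernel t (y + z) + heatKernel t (y - z) - 2 * heatKernel t y =
        (4 * Real.pi * t) ^ (-(N : ℝ) / 2) *
        (Real.exp (-b ^ 2) * ((Real.exp (-ξ - s ^ 2 / 4) - 1 - (-ξ - s ^ 2 / 4)) +
          (Real.exp (ξ - s ^ 2 / 4) - 1 - (ξ - s ^ 2 / 4)) - s ^ 2 / 2)) := by
      rw [hk0, hk1, hk2]; ring
    rw [e, abs_mul, abs_mul, abs_of_nonneg hA, abs_of_pos hP]
    have h5 : |(Real.exp (-ξ - s ^ 2 / 4) - 1 - (-ξ - s ^ 2 / 4)) +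
          (Real.exp (ξ - s ^ 2 / 4) - 1 - (ξ - s ^ 2 / 4)) - s ^ 2 / 2| ≤
          5 * s ^ 2 * Real.exp (2 * b + 1 / 2) := by
      have a1 := hsecond _ hw1
      have a2 := hsecond _ hw2
      have a3 : s ^ 2 * 1 ≤ s ^ 2 * Real.exp (2 * b + 1 / 2) := by
        gcongr; exact Real.one_le_exp (by positivity)
      have a4 := sq_nonneg s
      rw [abs_le] at *
      constructor <;> linarith
    calc _ ≤ (4 * Real.pi * t) ^ (-(N : ℝ) / 2) *
          (Real.exp (-b ^ 2) * (5 * s ^ 2 * Real.exp (2 * b + 1 / 2))) := by gcongr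
      _ = (4 * Real.pi * t) ^ (-(N : ℝ) / 2) *
          (5 * s ^ 2 * (Real.exp (-b ^ 2) * Real.exp (2 * b + 1 / 2))) := by ring
      _ ≤ (4 * Real.pi * t) ^ (-(N : ℝ) / 2) *
          (5 * s ^ 2 * (Real.exp 2 * Real.exp (-(b ^ 2 / 4)))) := by gcongr
      _ = 5 * s ^ 2 * (Real.exp 2 * 4 ^ ((N : ℝ) / 2) * heatKernel (4 * t) y) := by rw [hR]; ring
      _ = _ := by ring


/-- The heat extension of a function `u`, i.e. its convolution with the heat kernel. -/
def heatExt {N : ℕ} (u : EuclideanSpace ℝ (Fin N) → ℝ) (t : ℝ) (x : EuclideanSpace ℝ (Fin N)) : ℝ :=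
  ∫ y, heatKernel t (x - y) * u y

section HeatExt

variable {N : ℕ} {u : EuclideanSpace ℝ (Fin N) → ℝ} {M : ℝ}

lemma integrable_heatKernel_mul (hu : Continuous u) (hM : ∀ x, |u x| ≤ M) {t : ℝ} (ht : 0 < t)
    (x : EuclideanSpace ℝ (Fin N)) : Integrable (fun y => heatKernel t (x - y) * u y) :=
  (integrable_heatKernel_sub ht x).mul_bdd (c := M) hu.aestronglyMeasurable
    (Eventually.of_forall hM)

lemma heatExt_le (hu : Continuous u) (hM : ∀ x, |u x| ≤ M) {S : ℝ} (hS : ∀ x, u x ≤ S) {t : ℝ}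
    (ht : 0 < t) (x : EuclideanSpace ℝ (Fin N)) : heatExt u t x ≤ S := by
  calc heatExt u t x ≤ ∫ y, heatKernel t (x - y) * S := by
        refine integral_mono (integrable_heatKernel_mul hu hM ht x)
          ((integrable_heatKernel_sub ht x).mul_const S) fun y => ?_
        exact mul_le_mul_of_nonneg_left (hS y) (heatKernel_nonneg ht _)
    _ = S := by rw [integral_mul_const, integral_heatKernel_sub ht, one_mul]

lemma abs_integral_mul_le (hM : ∀ x, |u x| ≤ M) {k h : EuclideanSpace ℝ (Fin N) → ℝ}
    (hh : Integrable h) (hk : ∀ y, |k y| ≤ h y) : |∫ y, k y * u y| ≤ (∫ y, h y) * M := by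
  rw [← integral_mul_const, ← Real.norm_eq_abs]
  refine norm_integral_le_of_norm_le (hh.mul_const M) (Eventually.of_forall fun y => ?_)
  rw [norm_mul]
  exact mul_le_mul (hk y) (hM y) (abs_nonneg _) ((abs_nonneg _).trans (hk y))

lemma abs_heatExt_le (hM : ∀ x, |u x| ≤ M) {t : ℝ} (ht : 0 < t)
    (x : EuclideanSpace ℝ (Fin N)) : |heatExt u t x| ≤ M := by
  have := abs_integral_mul_le hM (integrable_heatKernel_sub ht x)
    (fun y => (abs_of_nonneg (heatKernel_nonneg ht (x - y))).le)
  rwa [integral_heatKernel_sub ht, one_mul] at this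

lemma measurable_heatExt_time (hu : Continuous u) (x : EuclideanSpace ℝ (Fin N)) :
    Measurable (fun t => heatExt u t x) := by
  unfold heatExt
  refine (StronglyMeasurable.integral_prod_right (ν := volume)
    (f := fun (t : ℝ) (y : EuclideanSpace ℝ (Fin N)) => heatKernel t (x - y) * u y) ?_).measurable
  apply Measurable.stronglyMeasurable
  have h1 := hu.measurable
  unfold Function.uncurry
  simp only
  unfold heatKernel
  fun_prop

lemma measurable_heatExt (hu : Continuous u) (t : ℝ) :
    Measurable (heatExt u t) := by
  unfold heatExt
  refine (StronglyMeasurable.integral_prod_right (ν := volume)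
    (f := fun (x y : EuclideanSpace ℝ (Fin N)) => heatKernel t (x - y) * u y) ?_).measurable
  apply Measurable.stronglyMeasurable
  have h1 := hu.measurable
  unfold Function.uncurry
  simp only
  unfold heatKernel
  fun_prop

lemma exists_abs_heatExt_time_sub_le (hu : Continuous u) (hM : ∀ x, |u x| ≤ M) :
    ∃ C : ℝ, 0 ≤ C ∧ ∀ (x : EuclideanSpace ℝ (Fin N)) (t p : ℝ), 0 < t → 0 < p →
      |heatExt u (t * (1 + p)) x - heatExt u t x| ≤ C * p := by
  have hM0 : 0 ≤ M := (abs_nonneg _).trans (hM 0)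
  have hK : (0 : ℝ) ≤ (N / 2 + 4) * 4 ^ ((N : ℝ) / 2) := by positivity
  refine ⟨((N / 2 + 4) * 4 ^ ((N : ℝ) / 2)) * M + 2 * M, by positivity, fun x t p ht hp => ?_⟩
  have htp : 0 < t * (1 + p) := by positivity
  rcases le_total p 1 with hp1 | hp1
  · have h := abs_integral_mul_le hM
      (((integrable_heatKernel_sub (show 0 < 4 * t by positivity) x).const_mul
        (p * ((N / 2 + 4) * 4 ^ ((N : ℝ) / 2)))))
      (fun y => abs_heatKernel_sub_le ht hp hp1 (x - y))
    rw [integral_const_mul, integral_heatKernel_sub (by positivity)] at h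
    unfold heatExt
    rw [← integral_sub (integrable_heatKernel_mul hu hM htp x) (integrable_heatKernel_mul hu hM ht x)]
    simp_rw [← sub_mul]
    refine h.trans ?_
    nlinarith [mul_nonneg hp.le hM0]
  · have h1 := abs_heatExt_le hM ht x
    have h2 := abs_heatExt_le hM htp x
    have h3 := abs_sub (heatExt u (t * (1 + p)) x) (heatExt u t x)
    have h4 : 2 * M ≤ 2 * M * p := by nlinarith
    have h5 : 0 ≤ ((N / 2 + 4) * 4 ^ ((N : ℝ) / 2)) * M * p := by positivity
    nlinarith

lemma heatKernel_conv_heatExt (hu : Continuous u) (hM : ∀ x, |u x| ≤ M) {r t : ℝ} (hr : 0 < r)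
    (ht : 0 < t) (x : EuclideanSpace ℝ (Fin N)) :
    ∫ z, heatKernel r z * heatExt u t (x - z) = heatExt u (t + r) x := by
  let F : EuclideanSpace ℝ (Fin N) × EuclideanSpace ℝ (Fin N) → ℝ := fun w =>
    heatKernel r w.1 * (heatKernel t (x - w.1 - w.2) * u w.2)
  have hum := hu.measurable
  have hm : AEStronglyMeasurable F (volume.prod volume) := by
    apply Measurable.aestronglyMeasurable
    simp only [F]
    unfold heatKernel
    fun_prop
  have hF : Integrable F (volume.prod volume) := by
    rw [integrable_prod_iff hm]
    constructor
    · exact Eventually.of_forall fun z =>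
        (integrable_heatKernel_mul hu hM ht (x - z)).const_mul (heatKernel r z)
    · refine Integrable.mono' ((integrable_heatKernel hr).mul_const M)
        hm.norm.integral_prod_right' (Eventually.of_forall fun z => ?_)
      rw [Real.norm_of_nonneg (integral_nonneg fun _ => norm_nonneg _)]
      simp only [F, norm_mul, Real.norm_of_nonneg (heatKernel_nonneg hr _)]
      rw [integral_const_mul]
      refine mul_le_mul_of_nonneg_left ?_ (heatKernel_nonneg hr _)
      calc _ ≤ ∫ y, heatKernel t (x - z - y) * M := by
            refine integral_mono_of_nonneg (Eventually.of_forall fun _ => by positivity)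
              ((integrable_heatKernel_sub ht _).mul_const M) (Eventually.of_forall fun y => ?_)
            simp only [Real.norm_of_nonneg (heatKernel_nonneg ht _)]
            exact mul_le_mul_of_nonneg_left (hM y) (heatKernel_nonneg ht _)
        _ = M := by rw [integral_mul_const, integral_heatKernel_sub ht, one_mul]
  have h := integral_integral_swap (f := fun z y => F (z, y)) hF
  have h1 : ∀ z, ∫ y, F (z, y) = heatKernel r z * heatExt u t (x - z) := fun z =>
    integral_const_mul (heatKernel r z) _
  have h2 : ∀ y, ∫ z, F (z, y) = heatKernel (t + r) (x - y) * u y := by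
    intro y
    rw [← integral_heatKernel_mul_heatKernel hr ht, ← integral_mul_const]
    congr 1; ext z
    simp only [F]
    rw [sub_right_comm]; ring
  simp_rw [h1, h2] at h
  exact h

lemma heatExt_eq_integral_heatKernel_one {t : ℝ} (ht : 0 < t) (x : EuclideanSpace ℝ (Fin N)) :
    heatExt u t x = ∫ z, heatKernel 1 z * u (x - √t • z) := by
  have hst : 0 < √t := Real.sqrt_pos.2 ht
  have h1 : heatExt u t x = ∫ z, heatKernel t z * u (x - z) := by
    unfold heatExt
    rw [← integral_sub_left_eq_self (fun z => heatKernel t z * u (x - z)) volume x]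
    simp
  have h2 := Measure.integral_comp_smul volume (fun z => heatKernel t z * u (x - z)) (√t)
  rw [h1]
  have h3 : ∀ z : EuclideanSpace ℝ (Fin N), heatKernel 1 z = √t ^ N * heatKernel t (√t • z) := by
    intro z
    unfold heatKernel
    rw [norm_smul, mul_pow, Real.norm_of_nonneg hst.le, Real.sq_sqrt ht.le,
      Real.mul_rpow (by positivity) ht.le, mul_one, mul_one, ← mul_assoc]
    have e1 : √t ^ N = t ^ ((N : ℝ) / 2) := by
      rw [Real.sqrt_eq_rpow, ← Real.rpow_natCast, ← Real.rpow_mul ht.le]; congr 1; ring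
    have e2 : t ^ ((N : ℝ) / 2) * ((4 * Real.pi) ^ (-(N : ℝ) / 2) * t ^ (-(N : ℝ) / 2)) =
        (4 * Real.pi) ^ (-(N : ℝ) / 2) := by
      rw [mul_left_comm, ← Real.rpow_add ht, show (N : ℝ) / 2 + -N / 2 = 0 by ring,
        Real.rpow_zero, mul_one]
    rw [e1, e2]
    congr 2
    field_simp
  simp_rw [h3, mul_assoc]
  rw [integral_const_mul, h2, finrank_euclideanSpace_fin, abs_of_pos (by positivity), smul_eq_mul]
  field_simp

lemma tendsto_heatExt_zero (hu : Continuous u) (hM : ∀ x, |u x| ≤ M)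
    (x : EuclideanSpace ℝ (Fin N)) :
    Tendsto (fun t => heatExt u t x) (𝓝[>] 0) (𝓝 (u x)) := by
  have h : Tendsto (fun t : ℝ => ∫ z : EuclideanSpace ℝ (Fin N), heatKernel 1 z * u (x - √t • z))
      (𝓝[>] 0) (𝓝 (∫ z : EuclideanSpace ℝ (Fin N), heatKernel 1 z * u x)) := by
    refine tendsto_integral_filter_of_dominated_convergence
      (fun z : EuclideanSpace ℝ (Fin N) => heatKernel 1 z * M) ?_ ?_
      ((integrable_heatKernel one_pos).mul_const M) ?_
    · refine Eventually.of_forall fun t => ?_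
      exact ((continuous_heatKernel 1).mul (by fun_prop)).aestronglyMeasurable
    · refine Eventually.of_forall fun t => Eventually.of_forall fun z => ?_
      rw [norm_mul, Real.norm_of_nonneg (heatKernel_nonneg one_pos z)]
      exact mul_le_mul_of_nonneg_left (hM _) (heatKernel_nonneg one_pos z)
    · refine Eventually.of_forall fun z => ?_
      have hc : Continuous (fun t : ℝ => heatKernel 1 z * u (x - √t • z)) := by fun_prop
      have := (hc.tendsto 0).mono_left (nhdsWithin_le_nhds (s := Set.Ioi 0))
      simpa using this
  rw [integral_mul_const, integral_heatKernel one_pos, one_mul] at h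
  refine h.congr' ?_
  filter_upwards [self_mem_nhdsWithin] with t ht
  exact (heatExt_eq_integral_heatKernel_one ht x).symm

lemma tendsto_heatExt_sub_atTop (hu : Continuous u) (hM : ∀ x, |u x| ≤ M)
    (x x' : EuclideanSpace ℝ (Fin N)) :
    Tendsto (fun t => heatExt u t x - heatExt u t x') atTop (𝓝 0) := by
  obtain ⟨K, hK0, hK⟩ := heatKernel_diff_bounds N
  have h0 : Tendsto (fun t : ℝ => K * (‖x - x'‖ / √t) * M) atTop (𝓝 0) := by
    have := (tendsto_const_nhds (x := ‖x - x'‖)).div_atTop Real.tendsto_sqrt_atTop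
    simpa using (this.const_mul K).mul_const M
  refine squeeze_zero_norm' ?_ h0
  filter_upwards [eventually_gt_atTop 0, Real.tendsto_sqrt_atTop.eventually_ge_atTop ‖x - x'‖]
    with t ht ht2
  unfold heatExt
  rw [← integral_sub (integrable_heatKernel_mul hu hM ht x) (integrable_heatKernel_mul hu hM ht x')]
  simp_rw [← sub_mul]
  have h := abs_integral_mul_le hM
    ((integrable_heatKernel_sub (show 0 < 4 * t by positivity) x').const_mul
      (K * (‖x - x'‖ / √t)))
    (fun y => by
      have := (hK t (x' - y) (x - x') ht ht2).1
      rwa [show x' - y + (x - x') = x - y by abel] at this)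
  rwa [integral_const_mul, integral_heatKernel_sub (by positivity), mul_one] at h

end HeatExt


lemma integrable_min_one_sq_div {N : ℕ} (hN : 1 ≤ N) {α : ℝ} (hα1 : 0 < α) (hα2 : α < 2) :
    Integrable (fun z : EuclideanSpace ℝ (Fin N) => min 1 (‖z‖ ^ 2) / ‖z‖ ^ ((N : ℝ) + α)) := by
  have : Nontrivial (EuclideanSpace ℝ (Fin N)) := by
    apply Module.nontrivial_of_finrank_pos (R := ℝ)
    rw [finrank_euclideanSpace, Fintype.card_fin]; omega
  refine (integrable_fun_norm_addHaar (volume : Measure (EuclideanSpace ℝ (Fin N)))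
    (f := fun y : ℝ => min 1 (y ^ 2) / y ^ ((N : ℝ) + α))).2 ?_
  rw [finrank_euclideanSpace, Fintype.card_fin]
  have hpow : ∀ y : ℝ, 0 < y → y ^ (N - 1) = y ^ ((N : ℝ) - 1) := fun y hy => by
    rw [← Real.rpow_natCast]; push_cast [Nat.cast_sub hN]; rfl
  have h1 : ∀ y : ℝ, 0 < y → y ^ (N - 1) / y ^ ((N : ℝ) + α) = y ^ (-1 - α) := fun y hy => by
    rw [hpow y hy, ← Real.rpow_sub hy]; congr 1; ring
  rw [← Set.Ioc_union_Ioi_eq_Ioi zero_le_one]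
  refine IntegrableOn.union ?_ ?_
  · have h : IntegrableOn (fun y : ℝ => y ^ (1 - α)) (Set.Ioc 0 1) := by
      rw [← intervalIntegrable_iff_integrableOn_Ioc_of_le zero_le_one]
      exact intervalIntegral.intervalIntegrable_rpow' (by linarith)
    refine h.congr_fun (fun y hy => ?_) measurableSet_Ioc
    have hy2 : y ^ 2 ≤ 1 := by nlinarith [hy.1, hy.2]
    simp only [smul_eq_mul]
    rw [min_eq_right hy2, mul_div_left_comm, h1 y hy.1, ← Real.rpow_natCast, ← Real.rpow_add hy.1]
    congr 1; push_cast; ring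
  · have h : IntegrableOn (fun y : ℝ => y ^ (-1 - α)) (Set.Ioi 1) :=
      integrableOn_Ioi_rpow_of_lt (by linarith) one_pos
    refine h.congr_fun (fun y hy => ?_) measurableSet_Ioi
    have hy1 : (1 : ℝ) < y := hy
    have hy2 : 1 ≤ y ^ 2 := by nlinarith
    simp only [smul_eq_mul]
    rw [min_eq_left hy2, mul_div_left_comm, h1 y (by linarith), one_mul]

/-- Second-order difference quotients of a smooth compactly supported function are controlled by
`min 1 ‖z‖²`. -/
lemma exists_diff_bounds_of_hasCompactSupport {E : Type*} [NormedAddCommGroup E] [NormedSpace ℝ E]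
    {χ : E → ℝ} (hχ : ContDiff ℝ (⊤ : ℕ∞) χ) (hs : HasCompactSupport χ) (h0 : ∀ x, 0 ≤ χ x)
    (h1 : ∀ x, χ x ≤ 1) :
    ∃ K : ℝ, 1 ≤ K ∧ ∀ y z : E, |χ (y + z) - χ y| ≤ K * min 1 ‖z‖ ∧
      |χ (y + z) + χ (y - z) - 2 * χ y| ≤ K * min 1 (‖z‖ ^ 2) := by
  obtain ⟨C, hC⟩ := hχ.lipschitzWith_of_hasCompactSupport hs (by simp)
  have hd : ContDiff ℝ 1 (fderiv ℝ χ) := hχ.fderiv_right (by norm_cast)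
  obtain ⟨L, hL⟩ := hd.lipschitzWith_of_hasCompactSupport (hs.fderiv ℝ) (by simp)
  have hdiff : Differentiable ℝ χ := hχ.differentiable (by simp)
  refine ⟨2 + C + L, by have := C.2; have := L.2; linarith [C.coe_nonneg, L.coe_nonneg],
    fun y z => ⟨?_, ?_⟩⟩
  · have hl := hC.dist_le_mul (y + z) y
    rw [Real.dist_eq, dist_eq_norm, add_sub_cancel_left] at hl
    have hb : |χ (y + z) - χ y| ≤ 1 := by
      rw [abs_le]; constructor <;> linarith [h0 (y + z), h0 y, h1 (y + z), h1 y]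
    have hz := norm_nonneg z
    rcases min_cases (1 : ℝ) ‖z‖ with ⟨h, -⟩ | ⟨h, -⟩ <;> rw [h] <;>
      nlinarith [C.coe_nonneg, L.coe_nonneg, mul_nonneg L.coe_nonneg hz]
  · have hg : ∀ w ∈ (Set.univ : Set E), DifferentiableAt ℝ (fun w => χ (w + z) - χ w) w := by
      intro w _
      exact ((hdiff (w + z)).comp w (differentiableAt_id.add_const z)).sub (hdiff w)
    have hb : ∀ w ∈ (Set.univ : Set E), ‖fderiv ℝ (fun w => χ (w + z) - χ w) w‖ ≤ L * ‖z‖ := by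
      intro w _
      have hdz : DifferentiableAt ℝ (fun w => χ (w + z)) w :=
        (hdiff (w + z)).comp w (differentiableAt_id.add_const z)
      rw [fderiv_fun_sub hdz (hdiff w), fderiv_comp_add_right]
      have := hL.dist_le_mul (w + z) w
      rwa [dist_eq_norm, dist_eq_norm, add_sub_cancel_left] at this
    have h := Convex.norm_image_sub_le_of_norm_fderiv_le hg hb convex_univ
      (Set.mem_univ (y - z)) (Set.mem_univ y)
    rw [sub_add_cancel, sub_sub_cancel, Real.norm_eq_abs] at h
    have e : χ (y + z) - χ y - (χ y - χ (y - z)) = χ (y + z) + χ (y - z) - 2 * χ y := by ring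
    rw [e] at h
    have hb : |χ (y + z) + χ (y - z) - 2 * χ y| ≤ 2 := by
      rw [abs_le]
      constructor <;> linarith [h0 (y + z), h0 (y - z), h0 y, h1 (y + z), h1 (y - z), h1 y]
    have hz := sq_nonneg ‖z‖
    rcases min_cases (1 : ℝ) (‖z‖ ^ 2) with ⟨h', -⟩ | ⟨h', -⟩ <;> rw [h'] <;>
      nlinarith [C.coe_nonneg, L.coe_nonneg, mul_nonneg C.coe_nonneg hz]

/-- An integrable majorant for the second differences of the heat kernel. -/
def heatMajorant {N : ℕ} (t : ℝ) (y z : EuclideanSpace ℝ (Fin N)) : ℝ :=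
  heatKernel (4 * t) y + heatKernel t y + heatKernel t (y + z) + heatKernel t (y - z)

lemma heatMajorant_nonneg {N : ℕ} {t : ℝ} (ht : 0 < t) (y z : EuclideanSpace ℝ (Fin N)) :
    0 ≤ heatMajorant t y z := by
  have := heatKernel_nonneg (show 0 < 4 * t by positivity) y
  have := heatKernel_nonneg ht y
  have := heatKernel_nonneg ht (y + z)
  have := heatKernel_nonneg ht (y - z)
  unfold heatMajorant; positivity

lemma exists_heatKernel_diff_le_heatMajorant (N : ℕ) {t : ℝ} (ht : 0 < t) :
    ∃ K : ℝ, 0 ≤ K ∧ ∀ y z : EuclideanSpace ℝ (Fin N),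
      |heatKernel t (y + z) - heatKernel t y| ≤ K * min 1 ‖z‖ * heatMajorant t y z ∧
      |heatKernel t (y + z) + heatKernel t (y - z) - 2 * heatKernel t y| ≤
        K * min 1 (‖z‖ ^ 2) * heatMajorant t y z := by
  obtain ⟨K, hK0, hK⟩ := heatKernel_diff_bounds N
  have hst : 0 < √t := Real.sqrt_pos.2 ht
  have hsq : √t ^ 2 = t := Real.sq_sqrt ht.le
  refine ⟨(K + 2) * ((1 + (√t)⁻¹) ^ 2 * (1 + √t) ^ 2), by positivity, fun y z => ?_⟩
  have p1 := heatKernel_nonneg (show 0 < 4 * t by positivity) y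
  have p2 := heatKernel_nonneg ht y
  have p3 := heatKernel_nonneg ht (y + z)
  have p4 := heatKernel_nonneg ht (y - z)
  have hm := heatMajorant_nonneg ht y z
  have hz := norm_nonneg z
  set s := (√t)⁻¹ with hs
  have hs0 : 0 < s := by positivity
  have hst1 : s * √t = 1 := inv_mul_cancel₀ hst.ne'
  have hA : 1 ≤ (1 + s) * (1 + √t) := by nlinarith
  have hA2 : (1 + s) * (1 + √t) ≤ (1 + s) ^ 2 * (1 + √t) ^ 2 := by
    rw [← mul_pow]; nlinarith
  rcases le_or_gt ‖z‖ (√t) with h | h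
  · obtain ⟨h1, h2⟩ := hK t y z ht h
    have hH : heatKernel (4 * t) y ≤ heatMajorant t y z := by unfold heatMajorant; linarith
    have hb : ‖z‖ / √t ≤ (1 + s) * (1 + √t) * min 1 ‖z‖ := by
      rw [div_eq_mul_inv, ← hs]
      rcases min_cases (1 : ℝ) ‖z‖ with ⟨h', h''⟩ | ⟨h', h''⟩ <;> rw [h'] <;> nlinarith
    have hmin : (min 1 ‖z‖) ^ 2 = min 1 (‖z‖ ^ 2) := by
      rcases le_total 1 ‖z‖ with h' | h'
      · rw [min_eq_left h', min_eq_left (by nlinarith)]; norm_num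
      · rw [min_eq_right h', min_eq_right (by nlinarith)]
    have hmin0 : 0 ≤ min 1 ‖z‖ := le_min zero_le_one hz
    constructor
    · refine h1.trans ?_
      refine mul_le_mul ?_ hH p1 (by positivity)
      rw [mul_assoc]
      refine mul_le_mul (by linarith) (hb.trans ?_) (by positivity) (by positivity)
      gcongr
    · refine h2.trans ?_
      refine mul_le_mul ?_ hH p1 (by positivity)
      rw [mul_assoc]
      refine mul_le_mul (by linarith) ?_ (by positivity) (by positivity)
      rw [← hmin, ← mul_pow, ← mul_pow]
      gcongr
  · have hsz : 1 ≤ s * ‖z‖ := by rw [← hst1]; gcongr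
    have hm1 : 1 ≤ (1 + s) ^ 2 * (1 + √t) ^ 2 * min 1 ‖z‖ := by
      rcases min_cases (1 : ℝ) ‖z‖ with ⟨h', h''⟩ | ⟨h', h''⟩ <;> rw [h']
      · linarith
      · have : 1 ≤ (1 + s) * (1 + √t) * ‖z‖ := by nlinarith [mul_pos hs0 hst]
        nlinarith
    have hm2 : 1 ≤ (1 + s) ^ 2 * (1 + √t) ^ 2 * min 1 (‖z‖ ^ 2) := by
      rcases min_cases (1 : ℝ) (‖z‖ ^ 2) with ⟨h', h''⟩ | ⟨h', h''⟩ <;> rw [h']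
      · linarith
      · have : 1 ≤ (1 + s) * (1 + √t) * ‖z‖ := by nlinarith [mul_pos hs0 hst]
        rw [← mul_pow, ← mul_pow]; exact one_le_pow₀ this
    have aux : ∀ a m : ℝ, 1 ≤ (1 + s) ^ 2 * (1 + √t) ^ 2 * m → a ≤ 2 * heatMajorant t y z →
        a ≤ (K + 2) * ((1 + s) ^ 2 * (1 + √t) ^ 2) * m * heatMajorant t y z := by
      intro a m h1 h2
      refine h2.trans (mul_le_mul_of_nonneg_right ?_ hm)
      rw [mul_assoc]
      nlinarith
    constructor
    · apply aux _ _ hm1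
      unfold heatMajorant
      rw [abs_le]; constructor <;> linarith
    · apply aux _ _ hm2
      unfold heatMajorant
      rw [abs_le]; constructor <;> linarith

lemma integrable_prod_heatMajorant {N : ℕ} (hN : 1 ≤ N) {α : ℝ} (hα1 : 0 < α) (hα2 : α < 2) {t : ℝ}
    (ht : 0 < t) (x : EuclideanSpace ℝ (Fin N)) :
    Integrable (fun w : EuclideanSpace ℝ (Fin N) × EuclideanSpace ℝ (Fin N) =>
      heatMajorant t (w.1 - x) w.2 * (min 1 (‖w.2‖ ^ 2) / ‖w.2‖ ^ ((N : ℝ) + α)))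
      (volume.prod volume) := by
  have h4t : 0 < 4 * t := by positivity
  have hi : ∀ s : ℝ, 0 < s → ∀ a, Integrable (fun y : EuclideanSpace ℝ (Fin N) =>
      heatKernel s (y - a)) := fun s hs a => (integrable_heatKernel hs).comp_sub_right a
  have hv : ∀ s : ℝ, 0 < s → ∀ a : EuclideanSpace ℝ (Fin N), ∫ y, heatKernel s (y - a) = 1 :=
    fun s hs a => by
      rw [integral_sub_right_eq_self (fun y => heatKernel s y) a, integral_heatKernel hs]
  have e : ∀ y z, heatMajorant t (y - x) z = heatKernel (4 * t) (y - x) + heatKernel t (y - x) +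
      heatKernel t (y - (x - z)) + heatKernel t (y - (x + z)) := by
    intro y z; unfold heatMajorant; congr 2 <;> [congr 2; skip] <;> abel_nf
  have hI : ∀ z, Integrable (fun y => heatMajorant t (y - x) z) := by
    intro z
    simp_rw [e]
    exact (((hi _ h4t _).add (hi _ ht _)).add (hi _ ht _)).add (hi _ ht _)
  have hV : ∀ z, ∫ y, heatMajorant t (y - x) z = 4 := by
    intro z
    simp_rw [e]
    have i2 : Integrable fun y => heatKernel (4 * t) (y - x) + heatKernel t (y - x) :=
      (hi _ h4t _).add (hi _ ht _)
    have i3 : Integrable fun y => heatKernel (4 * t) (y - x) + heatKernel t (y - x) +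
        heatKernel t (y - (x - z)) := i2.add (hi _ ht _)
    rw [integral_add i3 (hi _ ht _), integral_add i2 (hi _ ht _),
      integral_add (hi _ h4t _) (hi _ ht _), hv _ h4t, hv _ ht, hv _ ht, hv _ ht]
    norm_num
  rw [integrable_prod_iff']
  · constructor
    · exact Eventually.of_forall fun z =>
        (hI z).mul_const (min 1 (‖z‖ ^ 2) / ‖z‖ ^ ((N : ℝ) + α))
    · refine ((integrable_min_one_sq_div hN hα1 hα2).const_mul 4).congr
        (Eventually.of_forall fun z => ?_)
      simp only
      rw [← hV z, ← integral_mul_const]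
      congr 1; ext y
      rw [Real.norm_of_nonneg]
      have := heatMajorant_nonneg ht (y - x) z
      positivity
  · apply Measurable.aestronglyMeasurable
    unfold heatMajorant heatKernel
    fun_prop

lemma abs_mul_second_diff_le {a b a₁ b₁ a₂ b₂ K L m n H : ℝ} (ha0 : 0 ≤ a) (ha1 : a ≤ 1)
    (hb0 : 0 ≤ b) (hbH : b ≤ H) (hL : 0 ≤ L) (hn0 : 0 ≤ n)
    (hmn : n * n = m)
    (h1 : |a₁ - a| ≤ L * n) (h2 : |a₂ - a| ≤ L * n) (h3 : |a₁ + a₂ - 2 * a| ≤ L * m)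
    (h4 : |b₁ - b| ≤ K * n * H) (h5 : |b₂ - b| ≤ K * n * H)
    (h6 : |b₁ + b₂ - 2 * b| ≤ K * m * H) :
    |a₁ * b₁ + a₂ * b₂ - 2 * (a * b)| ≤ (K + L + 2 * (K * L)) * m * H := by
  have hH : 0 ≤ H := hb0.trans hbH
  have e : a₁ * b₁ + a₂ * b₂ - 2 * (a * b) = a * (b₁ + b₂ - 2 * b) + b * (a₁ + a₂ - 2 * a) +
      (a₁ - a) * (b₁ - b) + (a₂ - a) * (b₂ - b) := by ring
  have i1 : |a * (b₁ + b₂ - 2 * b)| ≤ K * m * H := by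
    rw [abs_mul, abs_of_nonneg ha0]
    nlinarith [abs_nonneg (b₁ + b₂ - 2 * b)]
  have i2 : |b * (a₁ + a₂ - 2 * a)| ≤ H * (L * m) := by
    rw [abs_mul, abs_of_nonneg hb0]
    exact mul_le_mul hbH h3 (abs_nonneg _) hH
  have i3 : |(a₁ - a) * (b₁ - b)| ≤ L * n * (K * n * H) := by
    rw [abs_mul]; exact mul_le_mul h1 h4 (abs_nonneg _) (by positivity)
  have i4 : |(a₂ - a) * (b₂ - b)| ≤ L * n * (K * n * H) := by
    rw [abs_mul]; exact mul_le_mul h2 h5 (abs_nonneg _) (by positivity)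
  have e2 : L * n * (K * n * H) = L * K * m * H := by rw [← hmn]; ring
  rw [e2] at i3 i4
  rw [e]
  refine (abs_add_le _ _).trans ?_
  have := abs_add_le (a * (b₁ + b₂ - 2 * b) + b * (a₁ + a₂ - 2 * a)) ((a₁ - a) * (b₁ - b))
  have := abs_add_le (a * (b₁ + b₂ - 2 * b)) (b * (a₁ + a₂ - 2 * a))
  linarith

/-- Smooth cutoffs exhausting the space, with uniformly controlled differences. -/
lemma exists_cutoff (E : Type*) [NormedAddCommGroup E] [InnerProductSpace ℝ E]
    [FiniteDimensional ℝ E] :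
    ∃ (L : ℝ) (χ : ℕ → E → ℝ), 0 ≤ L ∧ (∀ n, ContDiff ℝ (⊤ : ℕ∞) (χ n)) ∧
      (∀ n, HasCompactSupport (χ n)) ∧ (∀ n y, 0 ≤ χ n y) ∧ (∀ n y, χ n y ≤ 1) ∧
      (∀ y, Tendsto (fun n => χ n y) atTop (𝓝 1)) ∧
      ∀ n y z, |χ n (y + z) - χ n y| ≤ L * min 1 ‖z‖ ∧
        |χ n (y + z) + χ n (y - z) - 2 * χ n y| ≤ L * min 1 (‖z‖ ^ 2) := by
  let f : ContDiffBump (0 : E) := ⟨1, 2, one_pos, one_lt_two⟩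
  obtain ⟨L, hL1, hL⟩ := exists_diff_bounds_of_hasCompactSupport (χ := f) f.contDiff
    f.hasCompactSupport (fun x => f.nonneg) (fun x => f.le_one)
  have hn : ∀ n : ℕ, (0 : ℝ) < ((n : ℝ) + 1)⁻¹ := fun n => by positivity
  have hn1 : ∀ n : ℕ, ((n : ℝ) + 1)⁻¹ ≤ 1 := fun n => inv_le_one_of_one_le₀ (by
    have : (0 : ℝ) ≤ n := by positivity
    linarith)
  refine ⟨L, fun n y => f (((n : ℝ) + 1)⁻¹ • y), by linarith, fun n => ?_, fun n => ?_,
    fun n y => f.nonneg, fun n y => f.le_one, fun y => ?_, fun n y z => ?_⟩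
  · exact f.contDiff.comp (contDiff_const_smul _)
  · exact f.hasCompactSupport.comp_smul (hn n).ne'
  · have h0 : Tendsto (fun n : ℕ => ((n : ℝ) + 1)⁻¹ • y) atTop (𝓝 ((0 : ℝ) • y)) := by
      refine Tendsto.smul_const ?_ y
      have := tendsto_one_div_add_atTop_nhds_zero_nat (𝕜 := ℝ)
      simpa using this
    rw [zero_smul] at h0
    have := (f.continuous.tendsto 0).comp h0
    rwa [f.eventuallyEq_one.eq_of_nhds] at this
  · have hz : ‖((n : ℝ) + 1)⁻¹ • z‖ ≤ ‖z‖ := by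
      rw [norm_smul, Real.norm_of_nonneg (hn n).le]
      exact mul_le_of_le_one_left (norm_nonneg _) (hn1 n)
    obtain ⟨h1, h2⟩ := hL (((n : ℝ) + 1)⁻¹ • y) (((n : ℝ) + 1)⁻¹ • z)
    simp only [smul_add, smul_sub]
    exact ⟨h1.trans (by gcongr), h2.trans (by gcongr)⟩

/-- Fatou's lemma followed by dominated convergence, for a sequence of the form `χₙ g`. -/
lemma integrable_and_tendsto_of_cutoff {X : Type*} [MeasurableSpace X] {μ : Measure X}
    {g : X → ℝ} {χ : ℕ → X → ℝ} {C : ℝ} (hg : ∀ᵐ y ∂μ, 0 ≤ g y) (hχ0 : ∀ n y, 0 ≤ χ n y)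
    (hχ1 : ∀ n y, χ n y ≤ 1) (hχ : ∀ᵐ y ∂μ, Tendsto (fun n => χ n y) atTop (𝓝 1))
    (hi : ∀ n, Integrable (fun y => χ n y * g y) μ) (hC : ∀ n, ∫ y, χ n y * g y ∂μ ≤ C) :
    Integrable g μ ∧ Tendsto (fun n => ∫ y, χ n y * g y ∂μ) atTop (𝓝 (∫ y, g y ∂μ)) := by
  have hlim : ∀ᵐ y ∂μ, Tendsto (fun n => χ n y * g y) atTop (𝓝 (g y)) := by
    filter_upwards [hχ] with y hy
    simpa using hy.mul_const (g y)
  have hgm : AEStronglyMeasurable g μ :=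
    aestronglyMeasurable_of_tendsto_ae atTop (fun n => (hi n).aestronglyMeasurable) hlim
  have hgi : Integrable g μ := by
    refine ⟨hgm, ?_⟩
    have h1 : ∫⁻ y, ‖g y‖ₑ ∂μ ≤ liminf (fun n => ∫⁻ y, ‖χ n y * g y‖ₑ ∂μ) atTop := by
      refine le_trans (le_of_eq ?_) (lintegral_liminf_le' fun n =>
        (hi n).aestronglyMeasurable.aemeasurable.enorm)
      exact lintegral_congr_ae (hlim.mono fun y hy => hy.enorm.liminf_eq.symm)
    refine lt_of_le_of_lt (h1.trans (liminf_le_of_le (by isBoundedDefault)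
      (fun b hb => ?_))) (ENNReal.ofReal_lt_top (r := C))
    obtain ⟨n, hn⟩ := hb.exists
    refine hn.trans ?_
    rw [← ofReal_integral_norm_eq_lintegral_enorm (hi n)]
    refine ENNReal.ofReal_le_ofReal (le_trans (le_of_eq ?_) (hC n))
    refine integral_congr_ae (hg.mono fun y hy => ?_)
    exact Real.norm_of_nonneg (mul_nonneg (hχ0 n y) hy)
  refine ⟨hgi, tendsto_integral_of_dominated_convergence g
    (fun n => (hi n).aestronglyMeasurable) hgi (fun n => hg.mono fun y hy => ?_) hlim⟩
  rw [Real.norm_of_nonneg (mul_nonneg (hχ0 n y) hy)]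
  exact mul_le_of_le_one_left hy (hχ1 n y)

lemma contDiff_heatKernel {N : ℕ} (t : ℝ) :
    ContDiff ℝ (⊤ : ℕ∞) (heatKernel t : EuclideanSpace ℝ (Fin N) → ℝ) := by
  unfold heatKernel
  exact contDiff_const.mul ((contDiff_const.mul (contDiff_norm_sq ℝ)).exp)

/-- The weak equation tested against the heat kernel. -/
lemma integral_mul_heatKernel_of_weak {N : ℕ} (hN : 1 ≤ N) {α : ℝ} (hα1 : 0 < α) (hα2 : α < 2)
    {u f : EuclideanSpace ℝ (Fin N) → ℝ} {M : ℝ} (hu : Continuous u) (hM : ∀ x, |u x| ≤ M)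
    (hf0 : ∀ x, 0 ≤ f x) (hfl : LocallyIntegrable f)
    (hw : ∀ θ : EuclideanSpace ℝ (Fin N) → ℝ, ContDiff ℝ (⊤ : ℕ∞) θ → HasCompactSupport θ →
      (∫ x, u x * fracLap N α θ x) = ∫ x, f x * θ x)
    {t : ℝ} (ht : 0 < t) (x : EuclideanSpace ℝ (Fin N)) :
    Integrable (fun y => f y * heatKernel t (x - y)) ∧
    Integrable (fun z => (heatExt u t (x + z) + heatExt u t (x - z) - 2 * heatExt u t x) /
      ‖z‖ ^ ((N : ℝ) + α)) ∧
    ∫ y, f y * heatKernel t (x - y) = fracLapCoeff N α / 2 *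
      ∫ z, (heatExt u t (x + z) + heatExt u t (x - z) - 2 * heatExt u t x) /
        ‖z‖ ^ ((N : ℝ) + α) := by
  have hM0 : 0 ≤ M := (abs_nonneg _).trans (hM 0)
  obtain ⟨L, χ, hL0, hχs, hχc, hχ0, hχ1, hχl, hχd⟩ := exists_cutoff (EuclideanSpace ℝ (Fin N))
  obtain ⟨K, hK0, hK⟩ := exists_heatKernel_diff_le_heatMajorant N ht
  have hmaj := (integrable_prod_heatMajorant hN hα1 hα2 ht x).const_mul
    (M * (K + L + 2 * (K * L)))
  set θ : EuclideanSpace ℝ (Fin N) → ℝ := fun y => heatKernel t (y - x) with hθ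
  have hθs : ContDiff ℝ (⊤ : ℕ∞) θ := (contDiff_heatKernel t).comp (contDiff_id.sub contDiff_const)
  have hθ0 : ∀ y, 0 ≤ θ y := fun y => heatKernel_nonneg ht _
  have hθeq : ∀ y, heatKernel t (x - y) = θ y := fun y => heatKernel_sub_comm t x y
  let F : ℕ → EuclideanSpace ℝ (Fin N) × EuclideanSpace ℝ (Fin N) → ℝ := fun n w =>
    u w.1 * ((χ n (w.1 + w.2) * θ (w.1 + w.2) + χ n (w.1 - w.2) * θ (w.1 - w.2) -
      2 * (χ n w.1 * θ w.1)) / ‖w.2‖ ^ ((N : ℝ) + α))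
  let G : EuclideanSpace ℝ (Fin N) × EuclideanSpace ℝ (Fin N) → ℝ := fun w =>
    u w.1 * ((θ (w.1 + w.2) + θ (w.1 - w.2) - 2 * θ w.1) / ‖w.2‖ ^ ((N : ℝ) + α))
  have hθm : Measurable θ := hθs.continuous.measurable
  have hum := hu.measurable
  have hFm : ∀ n, AEStronglyMeasurable (F n) (volume.prod volume) := fun n => by
    have := (hχs n).continuous.measurable
    exact Measurable.aestronglyMeasurable (by fun_prop)
  have hFle : ∀ n w, ‖F n w‖ ≤ M * (K + L + 2 * (K * L)) *
      (heatMajorant t (w.1 - x) w.2 * (min 1 (‖w.2‖ ^ 2) / ‖w.2‖ ^ ((N : ℝ) + α))) := by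
    rintro n ⟨y, z⟩
    have hk := hK (y - x) z
    have hk' := hK (y - x) (-z)
    have hc := hχd n y z
    have hc' := hχd n y (-z)
    have hH' : heatMajorant t (y - x) (-z) = heatMajorant t (y - x) z := by
      unfold heatMajorant; rw [← sub_eq_add_neg, sub_neg_eq_add]; ring
    rw [norm_neg, ← sub_eq_add_neg] at hk' hc'
    rw [hH'] at hk'
    have e1 : y - x + z = y + z - x := by abel
    have e2 : y - x - z = y - z - x := by abel
    rw [e1, e2] at hk
    rw [e2] at hk'
    have hH := heatMajorant_nonneg ht (y - x) z
    have hb : θ y ≤ heatMajorant t (y - x) z := by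
      have := heatKernel_nonneg (show 0 < 4 * t by positivity) (y - x)
      have := heatKernel_nonneg ht (y - x + z)
      have := heatKernel_nonneg ht (y - x - z)
      simp only [hθ]; unfold heatMajorant; linarith
    have hz := norm_nonneg z
    have hmin : min 1 ‖z‖ * min 1 ‖z‖ = min 1 (‖z‖ ^ 2) := by
      rcases le_total 1 ‖z‖ with h' | h'
      · rw [min_eq_left h', min_eq_left (by nlinarith)]; norm_num
      · rw [min_eq_right h', min_eq_right (by nlinarith)]; ring
    have key := abs_mul_second_diff_le (hχ0 n y) (hχ1 n y) (hθ0 y)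
        hb hL0 (by positivity) hmin hc.1 hc'.1 hc.2 hk.1 hk'.1 hk.2
    simp only [F, Real.norm_eq_abs, abs_mul, abs_div]
    rw [abs_of_nonneg (show 0 ≤ ‖z‖ ^ ((N : ℝ) + α) by positivity), mul_assoc]
    refine mul_le_mul (hM y) ?_ (by positivity) hM0
    rw [← mul_div_assoc, ← mul_div_assoc]
    refine div_le_div_of_nonneg_right (key.trans (le_of_eq (by ring))) (by positivity)
  have hFi : ∀ n, Integrable (F n) (volume.prod volume) := fun n =>
    hmaj.mono' (hFm n) (Eventually.of_forall (hFle n))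
  have hFG : ∀ w, Tendsto (fun n => F n w) atTop (𝓝 (G w)) := by
    rintro ⟨y, z⟩
    have := ((((hχl (y + z)).mul_const (θ (y + z))).add ((hχl (y - z)).mul_const (θ (y - z)))).sub
      (((hχl y).mul_const (θ y)).const_mul 2)).div_const (‖z‖ ^ ((N : ℝ) + α)) |>.const_mul (u y)
    simpa only [one_mul] using this
  have hGi : Integrable G (volume.prod volume) := by
    refine hmaj.mono' (aestronglyMeasurable_of_tendsto_ae atTop hFm (Eventually.of_forall hFG))
      (Eventually.of_forall fun w => ?_)
    exact le_of_tendsto (hFG w).norm (Eventually.of_forall fun n => hFle n w)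
  have hlimF : Tendsto (fun n => fracLapCoeff N α / 2 * ∫ w, F n w ∂(volume.prod volume)) atTop
      (𝓝 (fracLapCoeff N α / 2 * ∫ w, G w ∂(volume.prod volume))) :=
    (tendsto_integral_of_dominated_convergence _ hFm hmaj
      (fun n => Eventually.of_forall (hFle n)) (Eventually.of_forall hFG)).const_mul _
  have hweq : ∀ n, ∫ y, χ n y * (f y * θ y) =
      fracLapCoeff N α / 2 * ∫ w, F n w ∂(volume.prod volume) := by
    intro n
    have h := hw (fun y => χ n y * θ y) ((hχs n).mul hθs) (hχc n).mul_right
    rw [integral_prod _ (hFi n), ← integral_const_mul]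
    calc _ = ∫ y, f y * (χ n y * θ y) := by congr 1; ext y; ring
      _ = _ := by
        rw [← h]; congr 1; ext y
        simp only [F, fracLap]
        rw [integral_const_mul]; ring
  have hfi : ∀ n, Integrable (fun y => χ n y * (f y * θ y)) := by
    intro n
    have := hfl.integrable_smul_left_of_hasCompactSupport
      ((hχs n).continuous.mul hθs.continuous) (hχc n).mul_right
    refine this.congr (Eventually.of_forall fun y => ?_)
    simp only [Pi.mul_apply, smul_eq_mul]; ring
  obtain ⟨C, hC⟩ : ∃ C, ∀ n, ∫ y, χ n y * (f y * θ y) ≤ C := by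
    obtain ⟨C, hC⟩ := hlimF.bddAbove_range
    exact ⟨C, fun n => (hweq n).le.trans (hC ⟨n, rfl⟩)⟩
  obtain ⟨hI, hT⟩ := integrable_and_tendsto_of_cutoff
    (Eventually.of_forall fun y => mul_nonneg (hf0 y) (hθ0 y)) hχ0 hχ1 (Eventually.of_forall hχl) hfi hC
  have hval : ∫ y, f y * θ y = fracLapCoeff N α / 2 * ∫ w, G w ∂(volume.prod volume) := by
    simp_rw [hweq] at hT
    exact tendsto_nhds_unique hT hlimF
  have hth : ∀ a : EuclideanSpace ℝ (Fin N), Integrable (fun y => u y * heatKernel t (y - a)) := by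
    intro a
    refine (integrable_heatKernel_mul hu hM ht a).congr (Eventually.of_forall fun y => ?_)
    simp only [heatKernel_sub_comm t a y, mul_comm]
  have htv : ∀ a : EuclideanSpace ℝ (Fin N), ∫ y, u y * heatKernel t (y - a) = heatExt u t a := by
    intro a
    unfold heatExt
    congr 1; ext y
    rw [heatKernel_sub_comm t a y, mul_comm]
  have hGz : ∀ z, ∫ y, G (y, z) = (heatExt u t (x + z) + heatExt u t (x - z) -
      2 * heatExt u t x) / ‖z‖ ^ ((N : ℝ) + α) := by
    intro z
    have e : ∀ y, G (y, z) = (u y * heatKernel t (y - (x + z)) + u y * heatKernel t (y - (x - z)) -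
        2 * (u y * heatKernel t (y - x))) / ‖z‖ ^ ((N : ℝ) + α) := by
      intro y
      simp only [G, hθ]
      rw [show y + z - x = y - (x - z) by abel, show y - z - x = y - (x + z) by abel]
      ring
    simp_rw [e]
    have i2 : Integrable fun y => u y * heatKernel t (y - (x + z)) +
      u y * heatKernel t (y - (x - z)) := (hth _).add (hth _)
    rw [integral_div, integral_sub i2 ((hth x).const_mul 2), integral_add (hth _) (hth _),
      integral_const_mul, htv, htv, htv]
  simp_rw [hθeq]
  refine ⟨hI, ?_, ?_⟩
  · simpa only [hGz] using hGi.integral_prod_right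
  · rw [hval, integral_prod_symm _ hGi]
    simp_rw [hGz]

/-- The fractional Laplacian of the caloric extension is a Marchaud derivative in time. -/
lemma fracLapCoeff_mul_integral_eq_marchaud {N : ℕ} {α : ℝ} (hα1 : 0 < α)
    {u : EuclideanSpace ℝ (Fin N) → ℝ} {M : ℝ} (hu : Continuous u) (hM : ∀ x, |u x| ≤ M)
    {t : ℝ} (ht : 0 < t) (x : EuclideanSpace ℝ (Fin N))
    (hQ : Integrable (fun z => (heatExt u t (x + z) + heatExt u t (x - z) - 2 * heatExt u t x) /
      ‖z‖ ^ ((N : ℝ) + α))) :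
    fracLapCoeff N α / 2 *
      ∫ z, (heatExt u t (x + z) + heatExt u t (x - z) - 2 * heatExt u t x) / ‖z‖ ^ ((N : ℝ) + α) =
    |Real.Gamma (-α / 2)|⁻¹ * ∫ r in Set.Ioi (0 : ℝ),
      r ^ (-1 - α / 2) * (heatExt u (t + r) x - heatExt u t x) := by
  set Q : EuclideanSpace ℝ (Fin N) → ℝ := fun z =>
    heatExt u t (x + z) + heatExt u t (x - z) - 2 * heatExt u t x with hQdef
  set A : ℝ := 2 ^ α * Real.pi ^ (-(N : ℝ) / 2) * Real.Gamma (((N : ℝ) + α) / 2) with hA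
  have hγ : 0 < (N : ℝ) / 2 - (-(α / 2)) := by
    have : (0 : ℝ) ≤ N := Nat.cast_nonneg N
    linarith
  have hker : ∀ z : EuclideanSpace ℝ (Fin N), Q z * ∫ r in Set.Ioi (0 : ℝ),
      r ^ (-1 - α / 2) * heatKernel r z = A * (Q z / ‖z‖ ^ ((N : ℝ) + α)) := by
    intro z
    by_cases hz : z = 0
    · have : Q z = 0 := by simp only [hQdef, hz, add_zero, sub_zero]; ring
      simp [this]
    · have h := integral_rpow_mul_heatKernel hγ hz
      rw [show -(α / 2) - 1 = -1 - α / 2 by ring, show -2 * -(α / 2) = α by ring,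
        show (N : ℝ) / 2 - -(α / 2) = ((N : ℝ) + α) / 2 by ring,
        show 2 * -(α / 2) - (N : ℝ) = -((N : ℝ) + α) by ring, Real.rpow_neg (norm_nonneg z)] at h
      rw [h, hA]; ring
  have hQm : Measurable Q := by
    have := measurable_heatExt hu t
    simp only [hQdef]; fun_prop
  let F : EuclideanSpace ℝ (Fin N) × ℝ → ℝ := fun w =>
    Q w.1 * (w.2 ^ (-1 - α / 2) * heatKernel w.2 w.1)
  have hFm : AEStronglyMeasurable F (volume.prod (volume.restrict (Set.Ioi (0 : ℝ)))) := by
    apply Measurable.aestronglyMeasurable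
    simp only [F]; unfold heatKernel; fun_prop
  have hnorm : ∀ z, ∫ r in Set.Ioi (0 : ℝ), ‖F (z, r)‖ = |A| * ‖Q z / ‖z‖ ^ ((N : ℝ) + α)‖ := by
    intro z
    have hpos : ∀ r ∈ Set.Ioi (0 : ℝ), 0 ≤ r ^ (-1 - α / 2) * heatKernel r z := fun r hr =>
      mul_nonneg (Real.rpow_nonneg (le_of_lt hr) _) (heatKernel_nonneg hr _)
    rw [← Real.norm_eq_abs A, ← norm_mul, ← hker z, norm_mul,
      Real.norm_of_nonneg (setIntegral_nonneg measurableSet_Ioi hpos), ← integral_const_mul]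
    refine setIntegral_congr_fun measurableSet_Ioi fun r hr => ?_
    simp only [F]
    rw [norm_mul, Real.norm_of_nonneg (hpos r hr)]
  have hFi : Integrable F (volume.prod (volume.restrict (Set.Ioi (0 : ℝ)))) := by
    rw [integrable_prod_iff hFm]
    constructor
    · refine Eventually.of_forall fun z => ?_
      by_cases hz : z = 0
      · have : Q z = 0 := by simp only [hQdef, hz, add_zero, sub_zero]; ring
        simp [F, this]
      · have h := (integrableOn_rpow_mul_heatKernel hγ hz).const_mul (Q z)
        rw [show -(α / 2) - 1 = -1 - α / 2 by ring] at h
        exact h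
    · simp_rw [hnorm]
      exact hQ.norm.const_mul _
  have h1 : ∀ z, ∫ r in Set.Ioi (0 : ℝ), F (z, r) = A * (Q z / ‖z‖ ^ ((N : ℝ) + α)) := fun z => by
    rw [← hker z, ← integral_const_mul]
  have hV : ∀ x', |heatExt u t x'| ≤ M := abs_heatExt_le hM ht
  have hVm := measurable_heatExt hu t
  have h2 : ∀ r : ℝ, 0 < r → ∫ z, F (z, r) =
      2 * (r ^ (-1 - α / 2) * (heatExt u (t + r) x - heatExt u t x)) := by
    intro r hr
    have i1 : Integrable fun z => heatKernel r z * heatExt u t (x + z) := by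
      refine ((integrable_heatKernel hr).mul_const M).mono'
        (Measurable.aestronglyMeasurable (by
          have := (continuous_heatKernel (N := N) r).measurable
          fun_prop))
        (Eventually.of_forall fun z => ?_)
      rw [norm_mul, Real.norm_of_nonneg (heatKernel_nonneg hr _)]
      exact mul_le_mul_of_nonneg_left (hV _) (heatKernel_nonneg hr _)
    have i2 : Integrable fun z => heatKernel r z * heatExt u t (x - z) := by
      refine i1.comp_neg.congr (Eventually.of_forall fun z => ?_)
      simp only [heatKernel_neg, sub_eq_add_neg]
    have v2 := heatKernel_conv_heatExt hu hM hr ht x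
    have v1 : ∫ z, heatKernel r z * heatExt u t (x + z) = heatExt u (t + r) x := by
      rw [← v2, ← integral_neg_eq_self]
      simp only [heatKernel_neg, sub_eq_add_neg]
    have e : ∀ z, F (z, r) = r ^ (-1 - α / 2) * (heatKernel r z * heatExt u t (x + z) +
        heatKernel r z * heatExt u t (x - z) - 2 * heatExt u t x * heatKernel r z) := by
      intro z; simp only [F, hQdef]; ring
    simp_rw [e]
    have i3 : Integrable fun z => heatKernel r z * heatExt u t (x + z) +
        heatKernel r z * heatExt u t (x - z) := i1.add i2
    rw [integral_const_mul, integral_sub i3 ((integrable_heatKernel hr).const_mul _),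
      integral_add i1 i2, integral_const_mul, integral_heatKernel hr, v1, v2]
    ring
  have h := integral_integral_swap (f := fun z r => F (z, r)) hFi
  simp_rw [h1] at h
  rw [setIntegral_congr_fun measurableSet_Ioi (fun r hr => h2 r hr), integral_const_mul,
    integral_const_mul] at h
  have hc : fracLapCoeff N α = A * |Real.Gamma (-α / 2)|⁻¹ := by rw [fracLapCoeff, hA]; rfl
  rw [hc]
  linear_combination (|Real.Gamma (-α / 2)|⁻¹ / 2) * h

/-- The average of `w` with respect to the beta prime distribution of parameter `1 - β`. -/
def betaMean (β : ℝ) (w : ℝ → ℝ) : ℝ :=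
  (Real.Gamma β * Real.Gamma (1 - β))⁻¹ * ∫ q in Set.Ioi (0 : ℝ), q ^ (-β) * (1 + q)⁻¹ * w q

section BetaMean

variable {β : ℝ} {w w' : ℝ → ℝ} {M : ℝ}

lemma integrableOn_betaMean (hβ0 : 0 < β) (hβ1 : β < 1) (hw : Measurable w)
    (hM : ∀ q, 0 < q → |w q| ≤ M) :
    IntegrableOn (fun q => q ^ (-β) * (1 + q)⁻¹ * w q) (Set.Ioi 0) := by
  refine ((integrableOn_rpow_neg_div_one_add hβ0 hβ1).mul_const M).mono'
    (Measurable.aestronglyMeasurable (by fun_prop)) ?_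
  filter_upwards [self_mem_ae_restrict measurableSet_Ioi] with q hq
  have hq0 : (0 : ℝ) < q := hq
  rw [norm_mul, Real.norm_of_nonneg (by positivity)]
  exact mul_le_mul_of_nonneg_left (hM q hq0) (by positivity)

lemma betaMean_sub (hβ0 : 0 < β) (hβ1 : β < 1) (hw : Measurable w) (hw' : Measurable w')
    (hM : ∀ q, 0 < q → |w q| ≤ M) (hM' : ∀ q, 0 < q → |w' q| ≤ M) :
    betaMean β w - betaMean β w' = betaMean β (fun q => w q - w' q) := by
  unfold betaMean
  rw [← mul_sub, ← integral_sub (integrableOn_betaMean hβ0 hβ1 hw hM)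
    (integrableOn_betaMean hβ0 hβ1 hw' hM')]
  simp_rw [mul_sub]

lemma betaMean_const (hβ0 : 0 < β) (hβ1 : β < 1) (S : ℝ) : betaMean β (fun _ => S) = S := by
  unfold betaMean
  have h1 := Real.Gamma_pos_of_pos hβ0
  have h2 := Real.Gamma_pos_of_pos (sub_pos.2 hβ1)
  rw [integral_mul_const, integral_rpow_neg_div_one_add hβ0 hβ1, inv_mul_cancel_left₀]
  positivity

lemma betaMean_le (hβ0 : 0 < β) (hβ1 : β < 1) (hw : Measurable w)
    (hM : ∀ q, 0 < q → |w q| ≤ M) {S : ℝ} (hS : ∀ q, 0 < q → w q ≤ S) : betaMean β w ≤ S := by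
  rw [← betaMean_const hβ0 hβ1 S]
  have h1 := Real.Gamma_pos_of_pos hβ0
  have h2 := Real.Gamma_pos_of_pos (sub_pos.2 hβ1)
  refine mul_le_mul_of_nonneg_left ?_ (by positivity)
  refine setIntegral_mono_on (integrableOn_betaMean hβ0 hβ1 hw hM)
    ((integrableOn_rpow_neg_div_one_add hβ0 hβ1).mul_const S) measurableSet_Ioi fun q hq => ?_
  have hq0 : (0 : ℝ) < q := hq
  exact mul_le_mul_of_nonneg_left (hS q hq0) (by positivity)

lemma abs_betaMean_le (hβ0 : 0 < β) (hβ1 : β < 1) (hw : Measurable w)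
    (hM : ∀ q, 0 < q → |w q| ≤ M) : |betaMean β w| ≤ M := by
  have h1 := betaMean_le hβ0 hβ1 hw hM (fun q hq => (abs_le.1 (hM q hq)).2)
  have h2 := betaMean_le hβ0 hβ1 hw.neg (fun q hq => (abs_neg (w q)).le.trans (hM q hq))
    (fun q hq => neg_le.1 (abs_le.1 (hM q hq)).1)
  have h3 : betaMean β (-w) = -betaMean β w := by
    simp only [betaMean, Pi.neg_apply, mul_neg, integral_neg]
  rw [h3] at h2
  exact abs_le.2 ⟨by linarith, h1⟩

lemma tendsto_betaMean (hβ0 : 0 < β) (hβ1 : β < 1) {W : ℕ → ℝ → ℝ} (hW : ∀ n, Measurable (W n))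
    (hM : ∀ n q, 0 < q → |W n q| ≤ M) {l : ℝ}
    (hl : ∀ q, 0 < q → Tendsto (fun n => W n q) atTop (𝓝 l)) :
    Tendsto (fun n => betaMean β (W n)) atTop (𝓝 l) := by
  rw [← betaMean_const hβ0 hβ1 l]
  refine Tendsto.const_mul _ (tendsto_integral_of_dominated_convergence
    (fun q => q ^ (-β) * (1 + q)⁻¹ * M) (fun n => Measurable.aestronglyMeasurable (by
      have := hW n
      fun_prop))
    ((integrableOn_rpow_neg_div_one_add hβ0 hβ1).mul_const M) (fun n => ?_) ?_)
  · filter_upwards [self_mem_ae_restrict measurableSet_Ioi] with q hq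
    have hq0 : (0 : ℝ) < q := hq
    rw [norm_mul, Real.norm_of_nonneg (by positivity)]
    exact mul_le_mul_of_nonneg_left (hM n q hq0) (by positivity)
  · filter_upwards [self_mem_ae_restrict measurableSet_Ioi] with q hq
    exact (hl q hq).const_mul _

end BetaMean

lemma mul_abs_Gamma_neg {β : ℝ} (hβ0 : 0 < β) (hβ1 : β < 1) :
    β * |Real.Gamma (-β)| = Real.Gamma (1 - β) := by
  have h := Real.Gamma_add_one (s := -β) (by linarith)
  have h2 := Real.Gamma_pos_of_pos (sub_pos.2 hβ1)
  rw [show -β + 1 = 1 - β by ring] at h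
  rw [← abs_of_pos h2, h, abs_mul, abs_neg, abs_of_pos hβ0]

section Representation

variable {N : ℕ} {α : ℝ} {u f : EuclideanSpace ℝ (Fin N) → ℝ} {M : ℝ}

/-- Time integrals of the caloric extension of the right-hand side. -/
lemma integral_rpow_mul_heatExt_rhs (hN : 1 ≤ N) (hα1 : 0 < α) (hα2 : α < 2)
    (hu : Continuous u) (hM : ∀ x, |u x| ≤ M) (hf0 : ∀ x, 0 ≤ f x) (hfl : LocallyIntegrable f)
    (hw : ∀ θ : EuclideanSpace ℝ (Fin N) → ℝ, ContDiff ℝ (⊤ : ℕ∞) θ → HasCompactSupport θ →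
      (∫ x, u x * fracLap N α θ x) = ∫ x, f x * θ x)
    {ε T : ℝ} (hε : 0 < ε) (hεT : ε ≤ T) (x : EuclideanSpace ℝ (Fin N)) :
    IntegrableOn (fun t => t ^ (α / 2 - 1) * ∫ y, f y * heatKernel t (x - y)) (Set.Ioc ε T) ∧
    ∫ t in Set.Ioc ε T, t ^ (α / 2 - 1) * ∫ y, f y * heatKernel t (x - y) =
      Real.Gamma (α / 2) * (betaMean (α / 2) (fun q => heatExt u (T * (1 + q)) x) -
        betaMean (α / 2) (fun q => heatExt u (ε * (1 + q)) x)) := by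
  have hβ0 : 0 < α / 2 := by linarith
  have hβ1 : α / 2 < 1 := by linarith
  have hT : 0 < T := hε.trans_le hεT
  have hM0 : 0 ≤ M := (abs_nonneg _).trans (hM 0)
  obtain ⟨C, hC0, hC⟩ := exists_abs_heatExt_time_sub_le hu hM
  have hvm := measurable_heatExt_time hu x
  obtain ⟨hI, hV⟩ := integral_rpow_mul_marchaud hβ0 hβ1 hvm hM0 hC0
    (fun t ht => abs_heatExt_le hM ht x) (hC x) hε hεT
  have hg : Set.EqOn (fun t => |Real.Gamma (-(α / 2))|⁻¹ * (t ^ (α / 2 - 1) *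
      ∫ r in Set.Ioi (0 : ℝ), r ^ (-1 - α / 2) * (heatExt u (t + r) x - heatExt u t x)))
      (fun t => t ^ (α / 2 - 1) * ∫ y, f y * heatKernel t (x - y)) (Set.Ioc ε T) := by
    intro t ht
    have ht0 : 0 < t := hε.trans ht.1
    obtain ⟨-, h2, h3⟩ := integral_mul_heatKernel_of_weak hN hα1 hα2 hu hM hf0 hfl hw ht0 x
    simp only
    rw [h3, fracLapCoeff_mul_integral_eq_marchaud hα1 hu hM ht0 x h2, neg_div]
    ring
  refine ⟨IntegrableOn.congr_fun (hI.const_mul _) hg measurableSet_Ioc, ?_⟩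
  have hvc : ∀ c : ℝ, Measurable fun q => heatExt u (c * (1 + q)) x := fun c =>
    hvm.comp (by fun_prop)
  rw [← setIntegral_congr_fun measurableSet_Ioc hg, integral_const_mul, hV,
    betaMean_sub hβ0 hβ1 (hvc T) (hvc ε)
      (fun q hq => abs_heatExt_le hM (by positivity) x)
      (fun q hq => abs_heatExt_le hM (by positivity) x), betaMean, ← mul_abs_Gamma_neg hβ0 hβ1]
  have h1 := Real.Gamma_pos_of_pos hβ0
  have h2 : 0 < |Real.Gamma (-(α / 2))| := by
    have := Real.Gamma_pos_of_pos (sub_pos.2 hβ1)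
    rw [← mul_abs_Gamma_neg hβ0 hβ1] at this
    exact pos_of_mul_pos_right this hβ0.le
  generalize (∫ q in Set.Ioi (0 : ℝ), q ^ (-(α / 2)) * (1 + q)⁻¹ *
    (heatExt u (T * (1 + q)) x - heatExt u (ε * (1 + q)) x)) = J
  field_simp

lemma tendsto_betaMean_sub (hN : 3 ≤ N) (hα1 : 0 < α) (hα2 : α < 2)
    (hu : Continuous u) (hM : ∀ x, |u x| ≤ M) (hf0 : ∀ x, 0 ≤ f x) (hfm : Measurable f)
    (hfl : LocallyIntegrable f)
    (hw : ∀ θ : EuclideanSpace ℝ (Fin N) → ℝ, ContDiff ℝ (⊤ : ℕ∞) θ → HasCompactSupport θ →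
      (∫ x, u x * fracLap N α θ x) = ∫ x, f x * θ x) (x : EuclideanSpace ℝ (Fin N)) :
    Tendsto (fun n : ℕ => betaMean (α / 2) (fun q => heatExt u (((n : ℝ) + 1) * (1 + q)) x) -
        betaMean (α / 2) (fun q => heatExt u (((n : ℝ) + 1)⁻¹ * (1 + q)) x)) atTop
      (𝓝 (rieszCoeff N α * ∫ y, f y * ‖x - y‖ ^ (-((N : ℝ) - α)))) := by
  have hβ0 : 0 < α / 2 := by linarith
  have hβ1 : α / 2 < 1 := by linarith
  have hΓ := Real.Gamma_pos_of_pos hβ0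
  have hN1 : 1 ≤ N := by omega
  have hN3 : (3 : ℝ) ≤ N := by exact_mod_cast hN
  have hγ : 0 < (N : ℝ) / 2 - α / 2 := by linarith
  have : Nontrivial (EuclideanSpace ℝ (Fin N)) := by
    apply Module.nontrivial_of_finrank_pos (R := ℝ)
    rw [finrank_euclideanSpace, Fintype.card_fin]; omega
  let μ : Measure (EuclideanSpace ℝ (Fin N) × ℝ) := volume.prod (volume.restrict (Set.Ioi (0 : ℝ)))
  let I : ℕ → Set ℝ := fun n => Set.Ioc ((n : ℝ) + 1)⁻¹ ((n : ℝ) + 1)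
  have hn0 : ∀ n : ℕ, (0 : ℝ) < (n : ℝ) + 1 := fun n => by positivity
  have hn1 : ∀ n : ℕ, ((n : ℝ) + 1)⁻¹ ≤ (n : ℝ) + 1 := fun n => by
    have h1 : (1 : ℝ) ≤ (n : ℝ) + 1 := by linarith [(Nat.cast_nonneg n : (0 : ℝ) ≤ n)]
    exact (inv_le_one_of_one_le₀ h1).trans h1
  have hI0 : ∀ n t, t ∈ I n → 0 < t := fun n t ht => (inv_pos.2 (hn0 n)).trans ht.1
  let P : EuclideanSpace ℝ (Fin N) × ℝ → ℝ := fun w =>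
    f w.1 * (w.2 ^ (α / 2 - 1) * heatKernel w.2 (x - w.1))
  let χ : ℕ → EuclideanSpace ℝ (Fin N) × ℝ → ℝ := fun n w => (I n).indicator 1 w.2
  have hχm : ∀ n, Measurable (χ n) := fun n =>
    (measurable_one.indicator measurableSet_Ioc).comp measurable_snd
  have hPm : Measurable P := by
    simp only [P]; unfold heatKernel; fun_prop
  have hker0 : ∀ (y : EuclideanSpace ℝ (Fin N)) (t : ℝ), 0 < t →
      0 ≤ t ^ (α / 2 - 1) * heatKernel t (x - y) := fun y t ht =>
    mul_nonneg (Real.rpow_nonneg ht.le _) (heatKernel_nonneg ht _)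
  have hmem : ∀ᵐ w ∂μ, (0 : ℝ) < w.2 :=
    Measure.quasiMeasurePreserving_snd.ae (self_mem_ae_restrict measurableSet_Ioi)
  have hP0 : ∀ᵐ w ∂μ, 0 ≤ P w := hmem.mono fun w hw => mul_nonneg (hf0 _) (hker0 _ _ hw)
  have hχ0 : ∀ n w, 0 ≤ χ n w := fun n w => Set.indicator_nonneg (fun _ _ => zero_le_one) _
  have hχ1 : ∀ n w, χ n w ≤ 1 := fun n w => Set.indicator_le_self' (fun _ _ => zero_le_one) _
  have hχl : ∀ᵐ w ∂μ, Tendsto (fun n => χ n w) atTop (𝓝 1) := by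
    filter_upwards [hmem] with w hw
    have h1 : ∀ᶠ n : ℕ in atTop, ((n : ℝ) + 1)⁻¹ < w.2 := by
      have := tendsto_one_div_add_atTop_nhds_zero_nat (𝕜 := ℝ)
      simp only [one_div] at this
      exact this.eventually_lt_const hw
    have h2 : ∀ᶠ n : ℕ in atTop, w.2 ≤ (n : ℝ) + 1 := by
      filter_upwards [tendsto_natCast_atTop_atTop.eventually_ge_atTop w.2] with n hn
      linarith
    refine tendsto_const_nhds.congr' ?_
    filter_upwards [h1, h2] with n hn1 hn2
    exact (Set.indicator_of_mem (show w.2 ∈ I n from ⟨hn1, hn2⟩) 1).symm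
  have hslice : ∀ n t, (fun y => χ n (y, t) * P (y, t)) = fun y =>
      (I n).indicator (fun t => t ^ (α / 2 - 1)) t * (f y * heatKernel t (x - y)) := by
    intro n t
    ext y
    simp only [χ, P]
    by_cases ht : t ∈ I n
    · rw [Set.indicator_of_mem ht, Set.indicator_of_mem ht]; simp only [Pi.one_apply]; ring
    · rw [Set.indicator_of_notMem ht, Set.indicator_of_notMem ht]; ring
  have hsliceV : ∀ n t, ∫ y, χ n (y, t) * P (y, t) = (I n).indicator
      (fun t => t ^ (α / 2 - 1) * ∫ y, f y * heatKernel t (x - y)) t := by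
    intro n t
    rw [hslice, integral_const_mul]
    by_cases ht : t ∈ I n
    · rw [Set.indicator_of_mem ht, Set.indicator_of_mem ht]
    · rw [Set.indicator_of_notMem ht, Set.indicator_of_notMem ht, zero_mul]
  have hrhs := fun n : ℕ => integral_rpow_mul_heatExt_rhs hN1 hα1 hα2 hu hM hf0 hfl hw
    (inv_pos.2 (hn0 n)) (hn1 n) x
  have hi : ∀ n, Integrable (fun w => χ n w * P w) μ := by
    intro n
    have hm : Measurable fun w => χ n w * P w := (hχm n).mul hPm
    rw [integrable_prod_iff' hm.aestronglyMeasurable]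
    constructor
    · filter_upwards [self_mem_ae_restrict measurableSet_Ioi] with t ht
      rw [hslice]
      exact (integral_mul_heatKernel_of_weak hN1 hα1 hα2 hu hM hf0 hfl hw ht x).1.const_mul _
    · have h1 : Integrable ((I n).indicator
          (fun t => t ^ (α / 2 - 1) * ∫ y, f y * heatKernel t (x - y)))
          (volume.restrict (Set.Ioi 0)) :=
        ((integrable_indicator_iff measurableSet_Ioc).2 (hrhs n).1).integrableOn
      refine h1.congr ?_
      filter_upwards [self_mem_ae_restrict measurableSet_Ioi] with t ht
      rw [← hsliceV]
      congr 1; ext y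
      exact (Real.norm_of_nonneg
        (mul_nonneg (hχ0 n _) (mul_nonneg (hf0 _) (hker0 _ _ ht)))).symm
  have hv : ∀ n : ℕ, ∫ w, χ n w * P w ∂μ = Real.Gamma (α / 2) *
      (betaMean (α / 2) (fun q => heatExt u (((n : ℝ) + 1) * (1 + q)) x) -
        betaMean (α / 2) (fun q => heatExt u (((n : ℝ) + 1)⁻¹ * (1 + q)) x)) := by
    intro n
    rw [← (hrhs n).2, integral_prod_symm _ (hi n)]
    simp_rw [hsliceV]
    have hsub : Set.Ioi (0 : ℝ) ∩ Set.Ioc ((n : ℝ) + 1)⁻¹ ((n : ℝ) + 1) =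
        Set.Ioc ((n : ℝ) + 1)⁻¹ ((n : ℝ) + 1) := Set.inter_eq_right.2 fun t ht => hI0 n t ht
    rw [setIntegral_indicator measurableSet_Ioc, hsub]
  have hbd : ∀ c : ℝ, 0 < c → |betaMean (α / 2) (fun q => heatExt u (c * (1 + q)) x)| ≤ M :=
    fun c hc => abs_betaMean_le hβ0 hβ1 ((measurable_heatExt_time hu x).comp (by fun_prop))
      (fun q hq => abs_heatExt_le hM (by positivity) x)
  obtain ⟨hPi, hPt⟩ := integrable_and_tendsto_of_cutoff (C := Real.Gamma (α / 2) * (M + M)) hP0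
    hχ0 hχ1 hχl hi (fun n => by
      rw [hv]
      have h1 := abs_le.1 (hbd _ (hn0 n))
      have h2 := abs_le.1 (hbd _ (inv_pos.2 (hn0 n)))
      gcongr
      linarith)
  have hval : ∫ w, P w ∂μ = Real.Gamma (α / 2) *
      (rieszCoeff N α * ∫ y, f y * ‖x - y‖ ^ (-((N : ℝ) - α))) := by
    rw [integral_prod _ hPi, ← integral_const_mul, ← integral_const_mul]
    refine integral_congr_ae ?_
    have hne : ∀ᵐ y : EuclideanSpace ℝ (Fin N), y ≠ x := by
      simp [ae_iff]
    filter_upwards [hne] with y hy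
    simp only [P]
    rw [integral_const_mul, integral_rpow_mul_heatKernel hγ (sub_ne_zero.2 hy.symm), rieszCoeff,
      show -2 * (α / 2) = -α by ring, show (N : ℝ) / 2 - α / 2 = ((N : ℝ) - α) / 2 by ring,
      show 2 * (α / 2) - (N : ℝ) = -((N : ℝ) - α) by ring]
    field_simp
  rw [hval] at hPt
  simp_rw [hv] at hPt
  have := hPt.const_mul (Real.Gamma (α / 2))⁻¹
  simpa only [inv_mul_cancel_left₀ hΓ.ne'] using this

end Representation

/-- every nonnegative entire bounded solution `u` of `Δ^{α/2}u = ρ·φ(u)`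
satisfies `u(x) + C_{N,α} ∫ ρ(y) φ(u(y)) |x-y|^{-(N-α)} dy = sup u`. -/
theorem stmt7 (N : ℕ) (hN : 3 ≤ N) (α : ℝ) (hα1 : 0 < α) (hα2 : α < 2)
    (ρ : EuclideanSpace ℝ (Fin N) → ℝ) (hρm : Measurable ρ) (hρnn : ∀ x, 0 ≤ ρ x)
    (hρlb : ∀ R : ℝ, ∃ M : ℝ, ∀ x : EuclideanSpace ℝ (Fin N), ‖x‖ ≤ R → ρ x ≤ M)
    (φ : ℝ → ℝ) (hφc : ContinuousOn φ (Set.Ici 0)) (hφm : MonotoneOn φ (Set.Ici 0))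
    (hφ0 : φ 0 = 0) (hφnn : ∀ t : ℝ, 0 ≤ t → 0 ≤ φ t)
    (u : EuclideanSpace ℝ (Fin N) → ℝ) (hu : IsEntireSol N α ρ φ u) :
    ∀ x : EuclideanSpace ℝ (Fin N),
      u x + rieszCoeff N α * ∫ y, ρ y * φ (u y) * ‖x - y‖ ^ (-((N : ℝ) - α)) =
        ⨆ z : EuclideanSpace ℝ (Fin N), u z := by
  obtain ⟨hcont, ⟨M, hMle⟩, hu0, hfl, hw⟩ := hu
  have hM : ∀ x, |u x| ≤ M := fun x => by rw [abs_of_nonneg (hu0 x)]; exact hMle x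
  have hφu : Continuous fun x => φ (u x) :=
    hφc.comp_continuous hcont fun x => hu0 x
  have hfm : Measurable fun x => ρ x * φ (u x) := hρm.mul hφu.measurable
  have hf0 : ∀ x, 0 ≤ ρ x * φ (u x) := fun x => mul_nonneg (hρnn x) (hφnn _ (hu0 x))
  have hβ0 : 0 < α / 2 := by linarith
  have hβ1 : α / 2 < 1 := by linarith
  have hN3 : (3 : ℝ) ≤ N := by exact_mod_cast hN
  have hbdd : BddAbove (Set.range u) := ⟨M, by rintro _ ⟨x, rfl⟩; exact hMle x⟩
  have hle : ∀ x, u x ≤ ⨆ z, u z := fun x => le_ciSup hbdd x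
  have hn0 : ∀ n : ℕ, (0 : ℝ) < (n : ℝ) + 1 := fun n => by positivity
  have hvm : ∀ (c : ℝ) x, Measurable fun q => heatExt u (c * (1 + q)) x := fun c x =>
    (measurable_heatExt_time hcont x).comp (by fun_prop)
  set A : ℕ → EuclideanSpace ℝ (Fin N) → ℝ := fun n x =>
    betaMean (α / 2) (fun q => heatExt u (((n : ℝ) + 1) * (1 + q)) x) with hA
  set B : EuclideanSpace ℝ (Fin N) → ℝ := fun x =>
    rieszCoeff N α * ∫ y, ρ y * φ (u y) * ‖x - y‖ ^ (-((N : ℝ) - α)) with hB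
  have hsmall : ∀ x, Tendsto (fun n : ℕ =>
      betaMean (α / 2) (fun q => heatExt u (((n : ℝ) + 1)⁻¹ * (1 + q)) x)) atTop (𝓝 (u x)) := by
    intro x
    refine tendsto_betaMean hβ0 hβ1 (fun n => hvm _ x)
      (fun n q hq => abs_heatExt_le hM (mul_pos (inv_pos.2 (hn0 n)) (by linarith)) x)
      (fun q hq => (tendsto_heatExt_zero hcont hM x).comp ?_)
    refine tendsto_nhdsWithin_iff.2 ⟨?_, Eventually.of_forall fun n =>
      mul_pos (inv_pos.2 (hn0 n)) (by linarith)⟩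
    have := (tendsto_one_div_add_atTop_nhds_zero_nat (𝕜 := ℝ)).mul_const (1 + q)
    simpa only [one_div, zero_mul] using this
  have hlim : ∀ x, Tendsto (fun n => A n x) atTop (𝓝 (u x + B x)) := by
    intro x
    have := (hsmall x).add (tendsto_betaMean_sub hN hα1 hα2 hcont hM hf0 hfm hfl hw x)
    simpa only [add_sub_cancel] using this
  have hconst : ∀ x x', u x + B x = u x' + B x' := by
    intro x x'
    have h1 := (hlim x).sub (hlim x')
    have h2 : Tendsto (fun n => A n x - A n x') atTop (𝓝 0) := by
      have h3 : ∀ n, A n x - A n x' = betaMean (α / 2) (fun q =>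
          heatExt u (((n : ℝ) + 1) * (1 + q)) x - heatExt u (((n : ℝ) + 1) * (1 + q)) x') :=
        fun n => betaMean_sub hβ0 hβ1 (hvm _ x) (hvm _ x')
          (fun q hq => abs_heatExt_le hM (mul_pos (hn0 n) (by linarith)) x)
          (fun q hq => abs_heatExt_le hM (mul_pos (hn0 n) (by linarith)) x')
      simp_rw [h3]
      refine tendsto_betaMean (M := M + M) hβ0 hβ1 (fun n => (hvm _ x).sub (hvm _ x'))
        (fun n q hq => (abs_sub _ _).trans (add_le_add
          (abs_heatExt_le hM (mul_pos (hn0 n) (by linarith)) x)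
          (abs_heatExt_le hM (mul_pos (hn0 n) (by linarith)) x')))
        (fun q hq => (tendsto_heatExt_sub_atTop hcont hM x x').comp ?_)
      exact (tendsto_natCast_atTop_atTop.atTop_add tendsto_const_nhds).atTop_mul_const
        (by linarith)
    linarith [tendsto_nhds_unique h1 h2]
  have hB0 : ∀ x, 0 ≤ B x := by
    intro x
    refine mul_nonneg ?_ (integral_nonneg fun y =>
      mul_nonneg (hf0 y) (Real.rpow_nonneg (norm_nonneg _) _))
    have h1 := Real.Gamma_pos_of_pos hβ0
    have h2 := Real.Gamma_pos_of_pos (show 0 < ((N : ℝ) - α) / 2 by linarith)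
    unfold rieszCoeff
    positivity
  intro x
  refine le_antisymm ?_ ?_
  · refine le_of_tendsto (hlim x) (Eventually.of_forall fun n => ?_)
    exact betaMean_le hβ0 hβ1 (hvm _ x)
      (fun q hq => abs_heatExt_le hM (mul_pos (hn0 n) (by linarith)) x)
      (fun q hq => heatExt_le hcont hM hle (mul_pos (hn0 n) (by linarith)) x)
  · refine ciSup_le fun z => ?_
    have := hconst x z
    have := hB0 z
    simp only [hB] at *
    linarith
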